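/- Let E be a Banach lattice and let A and B be bounded linear operators on E such that AB ≥ BA ≥ 0 (i.e., the product BA is a positive operator and the commutator C = AB − BA is a positive operator), and such that the product AB is a power-compact operator. Then the commutator C = AB − BA is quasi-nilpotent, i.e., lim_{n→∞} ‖Cⁿ‖^{1/n} = 0. -/

import Mathlib

open Filter Topology

/-- A compact operator has only finitely many eigenvalues outside a ball around zero. -/
lemma finite_setOf_hasEigenvalue_of_isCompactOperator {X : Type*} [NormedAddCommGroup X]
    [NormedSpace ℂ X] {V : X →L[ℂ] X} (hV : IsCompactOperator V) {δ : ℝ} (hδ : 0 < δ) :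
    {μ : ℂ | δ ≤ ‖μ‖ ∧ Module.End.HasEigenvalue (V : Module.End ℂ X) μ}.Finite := by
  by_contra hinf
  let e := Set.Infinite.natEmbedding _ hinf
  let μ : ℕ → ℂ := fun n => (e n : ℂ)
  have hμ (n : ℕ) : δ ≤ ‖μ n‖ := (e n).2.1
  have hμ_inj : Function.Injective μ := fun m n h => e.injective (Subtype.ext h)
  choose x hx using fun n => (e n).2.2.exists_hasEigenvector
  have hlin : LinearIndependent ℂ x :=
    Module.End.eigenvectors_linearIndependent' _ μ hμ_inj x hx
  let W : ℕ → Submodule ℂ X := fun n => Submodule.span ℂ (x '' Set.Iio n)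
  have hW_mono : Monotone W := fun m n h =>
    Submodule.span_mono (Set.image_mono (Set.Iio_subset_Iio h))
  have hxV (n : ℕ) : V (x n) = μ n • x n := (hx n).apply_eq_smul
  have hxW {k n : ℕ} (h : k < n) : x k ∈ W n := Submodule.subset_span ⟨k, h, rfl⟩
  have hVW {n : ℕ} {y : X} (hy : y ∈ W n) : V y ∈ W n := by
    refine Submodule.span_induction (p := fun y _ => V y ∈ W n) ?_ (by simp)
      (fun a b _ _ ha hb => by simpa using add_mem ha hb)
      (fun c a _ ha => by simpa using Submodule.smul_mem _ c ha) hy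
    rintro _ ⟨k, hk, rfl⟩
    rw [hxV]
    exact Submodule.smul_mem _ _ (hxW hk)
  have hVμ {n : ℕ} {y : X} (hy : y ∈ W (n + 1)) : V y - μ n • y ∈ W n := by
    refine Submodule.span_induction (p := fun y _ => V y - μ n • y ∈ W n) ?_ (by simp)
      (fun a b _ _ ha hb => ?_) (fun c a _ ha => ?_) hy
    · rintro _ ⟨k, hk, rfl⟩
      rw [hxV, ← sub_smul]
      rcases (Nat.lt_succ_iff.mp hk).lt_or_eq with hk | rfl
      · exact Submodule.smul_mem _ _ (hxW hk)
      · simp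
    · convert add_mem ha hb using 1
      simp only [map_add, smul_add]; abel
    · convert Submodule.smul_mem _ c ha using 1
      simp only [map_smul, smul_sub, smul_comm c]
  have hfar (n : ℕ) : ∃ y ∈ W (n + 1), ‖y‖ ≤ 3 ∧ ∀ v ∈ W n, 1 ≤ ‖y - v‖ := by
    have : FiniteDimensional ℂ (W n) :=
      FiniteDimensional.span_of_finite ℂ ((Set.finite_Iio n).image x)
    have hcl : IsClosed ((W n).comap (W (n + 1)).subtype : Set (W (n + 1))) :=
      (W n).closed_of_finiteDimensional.preimage continuous_subtype_val
    have hne : ∃ y : W (n + 1), y ∉ (W n).comap (W (n + 1)).subtype := by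
      refine ⟨⟨x n, hxW n.lt_succ_self⟩, fun h => ?_⟩
      exact hlin.notMem_span_image (s := Set.Iio n) (x := n) (by simp) h
    obtain ⟨y, hy, hyv⟩ := riesz_lemma_of_norm_lt (c := (2 : ℂ)) (R := 3) (by norm_num)
      (by norm_num) hcl hne
    exact ⟨y, y.2, hy, fun v hv => hyv ⟨v, hW_mono n.le_succ hv⟩ hv⟩
  choose y hyW hy hyv using hfar
  have hsep {m n : ℕ} (h : m < n) : δ ≤ ‖V (y n) - V (y m)‖ := by
    have h0 : μ n ≠ 0 := by
      intro h0
      have := hμ n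
      rw [h0, norm_zero] at this
      linarith
    set v : X := (μ n)⁻¹ • (V (y m) - (V (y n) - μ n • y n)) with hv
    have hvW : v ∈ W n :=
      Submodule.smul_mem _ _ (sub_mem (hVW (hW_mono h (hyW m))) (hVμ (hyW n)))
    have : V (y n) - V (y m) = μ n • (y n - v) := by
      rw [smul_sub, hv, smul_inv_smul₀ h0]; abel
    rw [this, norm_smul]
    nlinarith [hμ n, hyv n v hvW, norm_nonneg (μ n)]
  obtain ⟨K, hK, hK'⟩ := hV.image_closedBall_subset_compact 3
  obtain ⟨_, -, ψ, hψ, hψy⟩ := hK.tendsto_subseq (fun n ↦ hK' ⟨y n, by simp [hy], rfl⟩)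
  obtain ⟨N, hN⟩ := Metric.cauchySeq_iff'.mp hψy.cauchySeq δ hδ
  have h1 := hN (N + 1) N.le_succ
  rw [dist_eq_norm] at h1
  exact absurd (hsep (hψ N.lt_succ_self)) (not_le.mpr h1)

lemma circleIntegral_clm_comp {X Y : Type*} [NormedAddCommGroup X] [NormedSpace ℂ X]
    [CompleteSpace X] [NormedAddCommGroup Y] [NormedSpace ℂ Y] [CompleteSpace Y]
    (L : X →L[ℂ] Y) {f : ℂ → X} {c : ℂ} {R : ℝ} (hf : CircleIntegrable f c R) :
    (∮ z in C(c, R), L (f z)) = L (∮ z in C(c, R), f z) := by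
  simp only [circleIntegral]
  rw [← L.intervalIntegral_comp_comm hf.out]
  simp

/-- The Laurent coefficients of the resolvent on an annulus free of spectrum. -/
lemma exists_laurent_coefficients {A : Type*} [NormedRing A] [NormedAlgebra ℂ A] [CompleteSpace A]
    {V : A} {t s : ℝ} (ht : 0 < t) (hts : t ≤ s)
    (hres : ∀ z : ℂ, t ≤ ‖z‖ → ‖z‖ ≤ s → z ∈ resolventSet ℂ V) :
    ∃ (a : ℤ → A) (K : ℝ), (∀ n, Commute V (a n)) ∧
      (∀ n, V * a n = a (n + 1) - if n = -1 then 1 else 0) ∧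
      (∀ n, ‖a n‖ ≤ K * t ^ n) ∧ ∀ n, ‖a n‖ ≤ K * s ^ n := by
  have hs : 0 < s := ht.trans_le hts
  have hderiv {z : ℂ} (h1 : t ≤ ‖z‖) (h2 : ‖z‖ ≤ s) : HasDerivAt (resolvent V) _ z :=
    spectrum.hasDerivAt_resolvent_const_left (hres z h1 h2)
  set F : ℤ → ℂ → A := fun n z => z ^ n • resolvent V z with hF
  have hdiff (n : ℤ) {z : ℂ} (h1 : t ≤ ‖z‖) (h2 : ‖z‖ ≤ s) : DifferentiableAt ℂ (F n) z := by
    have hz : z ≠ 0 := norm_pos_iff.mp (ht.trans_le h1)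
    exact (differentiableAt_zpow.mpr (Or.inl hz)).smul (hderiv h1 h2).differentiableAt
  have hF_int (n : ℤ) : CircleIntegrable (F n) 0 t := by
    refine ContinuousOn.circleIntegrable ht.le fun z hz => ?_
    have hz : ‖z‖ = t := by simpa using hz
    exact (hdiff n hz.ge (hz.le.trans hts)).continuousAt.continuousWithinAt
  have heq (n : ℤ) : (∮ z in C(0, s), F n z) = ∮ z in C(0, t), F n z := by
    refine Complex.circleIntegral_eq_of_differentiable_on_annulus_off_countable ht hts
      Set.countable_empty (fun z hz => ?_) fun z hz => ?_
    · simp only [Set.mem_sdiff, Metric.mem_closedBall, dist_zero_right, Metric.mem_ball,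
        not_lt] at hz
      exact (hdiff n hz.2 hz.1).continuousAt.continuousWithinAt
    · simp only [Set.mem_sdiff, Metric.mem_closedBall, dist_zero_right, Metric.mem_ball,
        not_le, Set.mem_empty_iff_false, not_false_eq_true, and_true] at hz
      exact hdiff n hz.2.le hz.1.le
  obtain ⟨M, hM⟩ : ∃ M, ∀ z : ℂ, t ≤ ‖z‖ → ‖z‖ ≤ s → ‖resolvent V z‖ ≤ M := by
    have hcpt : IsCompact (Metric.closedBall (0 : ℂ) s \ Metric.ball 0 t) :=
      (isCompact_closedBall _ _).diff Metric.isOpen_ball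
    obtain ⟨M, hM⟩ := hcpt.exists_bound_of_continuousOn (f := resolvent V) fun z hz => by
      simp only [Set.mem_sdiff, Metric.mem_closedBall, dist_zero_right, Metric.mem_ball,
        not_lt] at hz
      exact (hderiv hz.2 hz.1).continuousAt.continuousWithinAt
    exact ⟨M, fun z h1 h2 => hM z (by simp [h1, h2])⟩
  have hbound (n : ℤ) {c : ℝ} (h1 : t ≤ c) (h2 : c ≤ s) :
      ‖(2 * Real.pi * Complex.I : ℂ)⁻¹ • ∮ z in C(0, c), F n z‖ ≤ s * |M| * c ^ n := by
    have hc : 0 < c := ht.trans_le h1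
    refine (circleIntegral.norm_two_pi_i_inv_smul_integral_le_of_norm_le_const hc.le
      (C := c ^ n * |M|) fun z hz => ?_).trans ?_
    · have hz : ‖z‖ = c := by simpa using hz
      rw [hF, norm_smul, norm_zpow, hz]
      gcongr
      exact (hM z (hz ▸ h1) (hz ▸ h2)).trans (le_abs_self M)
    · have : 0 ≤ c ^ n * |M| := by positivity
      nlinarith
  have hresolv {z : ℂ} (hz : ‖z‖ = t) : V * resolvent V z = z • resolvent V z - 1 ∧
      resolvent V z * V = z • resolvent V z - 1 := by
    have hu : IsUnit (algebraMap ℂ A z - V) := hres z hz.ge (hz.le.trans hts)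
    have h1 := Ring.mul_inverse_cancel _ hu
    have h2 := Ring.inverse_mul_cancel _ hu
    rw [Algebra.algebraMap_eq_smul_one] at h1 h2
    simp only [resolvent, Algebra.algebraMap_eq_smul_one]
    rw [sub_mul, smul_mul_assoc, one_mul] at h1
    rw [mul_sub, mul_smul_comm, mul_one] at h2
    exact ⟨(sub_eq_of_eq_add' (sub_eq_iff_eq_add.mp h1)).symm,
      (sub_eq_of_eq_add' (sub_eq_iff_eq_add.mp h2)).symm⟩
  have hzpow (n : ℤ) : (2 * Real.pi * Complex.I : ℂ)⁻¹ • (∮ z in C(0, t), z ^ n • (1 : A)) =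
      if n = -1 then 1 else 0 := by
    rw [circleIntegral.integral_smul_const]
    split_ifs with h
    · subst h
      have := circleIntegral.integral_sub_inv_of_mem_ball (c := 0) (w := 0) (R := t) (by simpa)
      simp only [sub_zero] at this
      simp only [zpow_neg_one, this, smul_smul]
      rw [inv_mul_cancel₀ Complex.two_pi_I_ne_zero, one_smul]
    · have := circleIntegral.integral_sub_zpow_of_ne h 0 0 t
      simp only [sub_zero] at this
      simp [this]
  have hmul (n : ℤ) (L : A →L[ℂ] A)
      (hL : ∀ z : ℂ, ‖z‖ = t → L (resolvent V z) = z • resolvent V z - 1) :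
      L ((2 * Real.pi * Complex.I : ℂ)⁻¹ • ∮ z in C(0, t), F n z) =
      ((2 * Real.pi * Complex.I : ℂ)⁻¹ • ∮ z in C(0, t), F (n + 1) z) -
        if n = -1 then 1 else 0 := by
    rw [map_smul, ← circleIntegral_clm_comp L (hF_int n), ← hzpow n, ← smul_sub,
      ← circleIntegral.integral_sub (hF_int (n + 1))]
    · congr 1
      refine circleIntegral.integral_congr ht.le fun z hz => ?_
      have hz : ‖z‖ = t := by simpa using hz
      have hz0 : z ≠ 0 := norm_pos_iff.mp (hz ▸ ht)
      simp only [hF, map_smul, hL z hz, smul_sub, smul_smul, zpow_add_one₀ hz0]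
    · refine ContinuousOn.circleIntegrable ht.le fun z hz => ?_
      have hz : ‖z‖ = t := by simpa using hz
      have hz0 : z ≠ 0 := norm_pos_iff.mp (hz ▸ ht)
      exact ((continuousAt_zpow₀ z n (Or.inl hz0)).smul
        continuousAt_const).continuousWithinAt
  refine ⟨fun n => (2 * Real.pi * Complex.I : ℂ)⁻¹ • ∮ z in C(0, t), F n z, s * |M|,
    fun n => ?_, fun n => ?_, fun n => hbound n le_rfl hts, fun n => ?_⟩
  · have h1 := hmul n (ContinuousLinearMap.mul ℂ A V) fun z hz => (hresolv hz).1
    have h2 := hmul n ((ContinuousLinearMap.mul ℂ A).flip V) fun z hz => (hresolv hz).2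
    exact h1.trans h2.symm
  · exact hmul n (ContinuousLinearMap.mul ℂ A V) fun z hz => (hresolv hz).1
  · simp only [← heq]
    exact hbound n hts le_rfl

/-- The complexification of a real normed space `E`, realised as `ℂ →L[ℝ] E`. -/
def Complexification (E : Type*) [NormedAddCommGroup E] [NormedSpace ℝ E] := ℂ →L[ℝ] E

namespace Complexification

variable {E : Type*} [NormedAddCommGroup E] [NormedSpace ℝ E]

noncomputable instance : NormedAddCommGroup (Complexification E) :=
  inferInstanceAs (NormedAddCommGroup (ℂ →L[ℝ] E))

instance [CompleteSpace E] : CompleteSpace (Complexification E) :=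
  inferInstanceAs (CompleteSpace (ℂ →L[ℝ] E))

noncomputable instance : FunLike (Complexification E) ℂ E :=
  inferInstanceAs (FunLike (ℂ →L[ℝ] E) ℂ E)

noncomputable instance : SMul ℂ (Complexification E) where
  smul z f := ContinuousLinearMap.comp (show ℂ →L[ℝ] E from f) (ContinuousLinearMap.mul ℝ ℂ z)

lemma smul_apply (z : ℂ) (f : Complexification E) (w : ℂ) : (z • f) w = f (z * w) := rfl

lemma add_apply (f g : Complexification E) (w : ℂ) : (f + g) w = f w + g w := rfl

lemma map_add' (f : Complexification E) (w w' : ℂ) : f (w + w') = f w + f w' :=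
  map_add (show ℂ →L[ℝ] E from f) w w'

lemma map_real_smul (f : Complexification E) (r : ℝ) (w : ℂ) : f (r • w) = r • f w :=
  map_smul (show ℂ →L[ℝ] E from f) r w

@[ext] lemma ext {f g : Complexification E} (h : ∀ w, f w = g w) : f = g := DFunLike.ext _ _ h

noncomputable instance : Module ℂ (Complexification E) where
  one_smul f := by ext w; simp [smul_apply]
  mul_smul z z' f := by ext w; simp only [smul_apply]; congr 1; ring
  smul_zero z := rfl
  smul_add z f g := rfl
  add_smul z z' f := by ext w; simp only [smul_apply, add_apply, add_mul, map_add']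
  zero_smul f := by
    ext w
    rw [smul_apply, zero_mul]
    exact map_zero (show ℂ →L[ℝ] E from f)

noncomputable instance : NormedSpace ℂ (Complexification E) where
  norm_smul_le z f := by
    refine (ContinuousLinearMap.opNorm_comp_le (show ℂ →L[ℝ] E from f) _).trans ?_
    rw [mul_comm]
    exact mul_le_mul_of_nonneg_right (ContinuousLinearMap.opNorm_mul_apply_le ℝ ℂ z)
      (norm_nonneg _)

lemma norm_apply_le (f : Complexification E) (w : ℂ) : ‖f w‖ ≤ ‖f‖ * ‖w‖ :=
  ContinuousLinearMap.le_opNorm (show ℂ →L[ℝ] E from f) w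

lemma norm_le_of_forall (f : Complexification E) {M : ℝ} (hM : 0 ≤ M)
    (h : ∀ w, ‖f w‖ ≤ M * ‖w‖) : ‖f‖ ≤ M :=
  ContinuousLinearMap.opNorm_le_bound (show ℂ →L[ℝ] E from f) hM h

/-- Evaluation at a complex number; evaluation at `1` is the real part. -/
noncomputable def eval (w : ℂ) : Complexification E →L[ℝ] E :=
  LinearMap.mkContinuous
    { toFun := fun f => f w
      map_add' := fun _ _ => rfl
      map_smul' := fun r f => by
        change f ((r : ℂ) * w) = r • f w
        rw [← map_real_smul, Complex.real_smul] } ‖w‖ fun f => by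
    rw [mul_comm]; exact norm_apply_le f w

/-- The real-linear embedding of `E` in its complexification. -/
noncomputable def ofReal : E →L[ℝ] Complexification E :=
  LinearMap.mkContinuous
    { toFun := fun x => (Complex.reCLM.smulRight x : ℂ →L[ℝ] E)
      map_add' := fun x y => ext fun w => smul_add w.re x y
      map_smul' := fun r x => ext fun w => by
        change w.re • r • x = ((r : ℂ) * w).re • x
        simp [smul_smul, mul_comm] } 1 fun x => by
    refine norm_le_of_forall _ (by positivity) fun w => ?_
    change ‖w.re • x‖ ≤ 1 * ‖x‖ * ‖w‖
    rw [norm_smul, one_mul, mul_comm]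
    exact mul_le_mul_of_nonneg_left (Complex.abs_re_le_norm w) (norm_nonneg x)

lemma ofReal_apply (x : E) (w : ℂ) : ofReal x w = w.re • x := rfl

/-- The complex-linear extension of a real operator. -/
noncomputable def lift (V : E →L[ℝ] E) : Complexification E →L[ℂ] Complexification E :=
  LinearMap.mkContinuous
    { toFun := fun f => (V.comp (show ℂ →L[ℝ] E from f) : ℂ →L[ℝ] E)
      map_add' := fun f g => ext fun w => map_add V (f w) (g w)
      map_smul' := fun _ _ => rfl } ‖V‖ fun f =>
    ContinuousLinearMap.opNorm_comp_le V (show ℂ →L[ℝ] E from f)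

lemma lift_apply (V : E →L[ℝ] E) (f : Complexification E) (w : ℂ) : lift V f w = V (f w) := rfl

lemma lift_ofReal (V : E →L[ℝ] E) (x : E) : lift V (ofReal x) = ofReal (V x) :=
  ext fun w => map_smul V w.re x

lemma isCompactOperator_lift {V : E →L[ℝ] E} (hV : IsCompactOperator V) :
    IsCompactOperator (lift V) := by
  obtain ⟨K, hK, hKV⟩ := hV
  let Φ : E × E → Complexification E := fun p => ofReal p.1 - Complex.I • ofReal p.2
  have hΦ : Continuous Φ := by fun_prop
  refine ⟨Φ '' (K ×ˢ K), (hK.prod hK).image hΦ, ?_⟩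
  have h (w : ℂ) : (fun f : Complexification E => f w) ⁻¹' (V ⁻¹' K) ∈ 𝓝 0 :=
    (eval (E := E) w).continuous.continuousAt.preimage_mem_nhds (by rwa [map_zero])
  filter_upwards [h 1, h Complex.I] with f h1 h2
  refine ⟨(V (f 1), V (f Complex.I)), ⟨h1, h2⟩, ext fun w => ?_⟩
  have : w = w.re • 1 + w.im • Complex.I := by
    rw [Complex.real_smul, Complex.real_smul, mul_one, Complex.re_add_im]
  conv_rhs => rw [lift_apply, this, map_add', map_real_smul, map_real_smul, map_add, map_smul,
    map_smul]
  change (w.re • V (f 1)) - (Complex.I * w).re • V (f Complex.I) = _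
  simp

/-- The real part of the restriction to `E` of a complex operator. -/
noncomputable def realPart (Z : Complexification E →L[ℂ] Complexification E) : E →L[ℝ] E :=
  eval 1 ∘L Z.restrictScalars ℝ ∘L ofReal

lemma realPart_lift_mul (V : E →L[ℝ] E) (Z : Complexification E →L[ℂ] Complexification E) :
    realPart (lift V * Z) = V * realPart Z := rfl

lemma realPart_mul_lift (V : E →L[ℝ] E) (Z : Complexification E →L[ℂ] Complexification E) :
    realPart (Z * lift V) = realPart Z * V := by
  ext x
  change (Z (lift V (ofReal x))) 1 = (Z (ofReal (V x))) 1
  rw [lift_ofReal]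

lemma realPart_one : realPart (1 : Complexification E →L[ℂ] Complexification E) = 1 := by
  ext x
  change ofReal x 1 = x
  simp [ofReal_apply]

lemma realPart_zero : realPart (0 : Complexification E →L[ℂ] Complexification E) = 0 := rfl

lemma realPart_sub (Z Z' : Complexification E →L[ℂ] Complexification E) :
    realPart (Z - Z') = realPart Z - realPart Z' := rfl

lemma norm_realPart_le (Z : Complexification E →L[ℂ] Complexification E) :
    ‖realPart Z‖ ≤ ‖Z‖ := by
  refine ContinuousLinearMap.opNorm_le_bound _ (norm_nonneg _) fun x => ?_
  have h1 : ‖realPart Z x‖ ≤ ‖Z (ofReal x)‖ * ‖(1 : ℂ)‖ := norm_apply_le (Z (ofReal x)) 1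
  have h2 : ‖(ofReal x : Complexification E)‖ ≤ ‖x‖ :=
    norm_le_of_forall _ (norm_nonneg x) fun w => by
      rw [ofReal_apply, norm_smul, mul_comm]
      exact mul_le_mul_of_nonneg_left (Complex.abs_re_le_norm w) (norm_nonneg x)
  rw [norm_one, mul_one] at h1
  exact h1.trans ((Z.le_opNorm _).trans (mul_le_mul_of_nonneg_left h2 (norm_nonneg _)))

end Complexification

lemma exists_riesz_decomposition {E : Type*} [NormedAddCommGroup E] [NormedSpace ℝ E]
    [CompleteSpace E] {V : E →L[ℝ] E} (hV : IsCompactOperator V) {δ : ℝ} (hδ : 0 < δ) :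
    ∃ (t s K : ℝ) (R : E →L[ℝ] E), 0 < t ∧ t < s ∧ s ≤ δ ∧ Commute V R ∧ R * V * R = R ∧
      (∀ n : ℕ, ‖V ^ n * (1 - V * R)‖ ≤ K * t ^ n) ∧
      ∀ n : ℕ, ‖R ^ n * (V * R)‖ ≤ K * s⁻¹ ^ n := by
  set VC := Complexification.lift V with hVC
  have hVCc : IsCompactOperator VC := Complexification.isCompactOperator_lift hV
  have hfin := (finite_setOf_hasEigenvalue_of_isCompactOperator hVCc (half_pos hδ)).image norm
  obtain ⟨t, s, h1, h2, h3, h4⟩ : ∃ t s : ℝ, δ / 2 < t ∧ t < s ∧ s ≤ δ ∧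
      ∀ z : ℂ, t ≤ ‖z‖ → ‖z‖ ≤ s → z ∈ resolventSet ℂ VC := by
    obtain ⟨c, hc, hcS⟩ := ((Set.Ioo_infinite (half_lt_self hδ)).sdiff hfin).nonempty
    have hopen : IsOpen (Set.Ioo (δ / 2) δ \ _) := isOpen_Ioo.sdiff hfin.isClosed
    obtain ⟨r, hr, hrS⟩ := Metric.isOpen_iff.mp hopen c ⟨hc, hcS⟩
    have hmem {x : ℝ} (hx1 : c - r / 2 ≤ x) (hx2 : x ≤ c + r / 2) := hrS (a := x) (by
      rw [Metric.mem_ball, Real.dist_eq, abs_lt]; constructor <;> linarith)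
    refine ⟨c - r / 2, c + r / 2, (hmem le_rfl (by linarith)).1.1, by linarith,
      (hmem (by linarith) le_rfl).1.2.le, fun z hz1 hz2 => ?_⟩
    obtain ⟨hz3, hz4⟩ := hmem hz1 hz2
    have hz : z ≠ 0 := norm_pos_iff.mp ((half_pos hδ).trans hz3.1)
    exact (hVCc.hasEigenvalue_or_mem_resolventSet hz).resolve_left
      fun h => hz4 ⟨z, ⟨hz3.1.le, h⟩, rfl⟩
  have ht : 0 < t := (half_pos hδ).trans h1
  have hs : 0 < s := ht.trans h2
  obtain ⟨b, K, hb1, hb2, hb3, hb4⟩ := exists_laurent_coefficients ht h2.le h4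
  obtain ⟨a, ha⟩ : ∃ a : ℤ → E →L[ℝ] E, a = fun n => Complexification.realPart (b n) := ⟨_, rfl⟩
  have hcomm (n : ℤ) : Commute V (a n) := by
    rw [ha, commute_iff_eq, ← Complexification.realPart_lift_mul, ← hVC, (hb1 n).eq, hVC,
      Complexification.realPart_mul_lift]
  have hmul (n : ℤ) : V * a n = a (n + 1) - if n = -1 then 1 else 0 := by
    simp only [ha]
    rw [← Complexification.realPart_lift_mul, ← hVC, hb2, Complexification.realPart_sub]
    split_ifs
    · rw [Complexification.realPart_one]
    · rw [Complexification.realPart_zero]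
  have hat (n : ℤ) : ‖a n‖ ≤ K * t ^ n := by
    rw [ha]; exact (Complexification.norm_realPart_le _).trans (hb3 n)
  have has (n : ℤ) : ‖a n‖ ≤ K * s ^ n := by
    rw [ha]; exact (Complexification.norm_realPart_le _).trans (hb4 n)
  have hK : 0 ≤ K := by simpa using (norm_nonneg _).trans (hat 0)
  have hpow (n : ℕ) : V ^ n * a 0 = a n := by
    induction n with
    | zero => simp
    | succ n ih =>
      rw [pow_succ', mul_assoc, ih, hmul, if_neg (by lia)]
      simp
  have hneg (n : ℕ) : V ^ n * a (-1 - n) = a (-1) := by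
    induction n with
    | zero => simp
    | succ n ih =>
      rw [pow_succ, mul_assoc, hmul, if_neg (by push_cast; lia), sub_zero, ← ih]
      congr 2
      push_cast
      ring
  have hP : V * -a (-1) = 1 - a 0 := by
    rw [mul_neg, hmul]; simp
  have hR0 : a (-1) * a 0 = 0 := by
    have hle (n : ℕ) : ‖a (-1) * a 0‖ ≤ K * s⁻¹ * K * (t / s) ^ n := by
      have heq : a (-1) * a 0 = a (-1 - n) * a n := by
        rw [← hneg n, ((hcomm _).pow_left n).eq, mul_assoc, hpow]
      rw [heq]
      refine (norm_mul_le _ _).trans ((mul_le_mul (has _) (hat _) (norm_nonneg _)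
        (by positivity)).trans_eq ?_)
      rw [zpow_sub₀ hs.ne', zpow_neg_one, zpow_natCast, zpow_natCast, div_pow]
      ring
    have hlim : Tendsto (fun n : ℕ => K * s⁻¹ * K * (t / s) ^ n) atTop (𝓝 0) := by
      simpa using (tendsto_pow_atTop_nhds_zero_of_lt_one (by positivity)
        ((div_lt_one hs).mpr h2)).const_mul (K * s⁻¹ * K)
    exact norm_le_zero_iff.mp (ge_of_tendsto' hlim hle)
  have hRVR : -a (-1) * V * -a (-1) = -a (-1) := by
    rw [mul_assoc, hP, mul_sub, mul_one, neg_mul, hR0, neg_zero, sub_zero]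
  have hVR : Commute V (-a (-1)) := (hcomm _).neg_right
  refine ⟨t, s, K + ‖V * -a (-1)‖ * K + ‖V * -a (-1)‖, -a (-1), ht, h2, h3, hVR, hRVR,
    fun n => ?_, fun n => ?_⟩
  · rw [hP, sub_sub_cancel, hpow]
    refine (hat n).trans ?_
    rw [zpow_natCast]
    gcongr
    have : 0 ≤ ‖1 - a 0‖ * K := by positivity
    linarith [norm_nonneg (1 - a 0)]
  · cases n with
    | zero =>
      have : 0 ≤ ‖V * -a (-1)‖ * K := by positivity
      simp only [pow_zero, one_mul, mul_one]
      linarith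
    | succ n =>
      have hidem : IsIdempotentElem (V * -a (-1)) := by
        rw [IsIdempotentElem, mul_assoc, ← mul_assoc (-a (-1)), hRVR]
      have h5 : V ^ (n + 1) * -a (-1 - n) = V * -a (-1) := by
        rw [pow_succ', mul_assoc, mul_neg, hneg]
      have h6 : (-a (-1)) ^ (n + 1) * (V * -a (-1)) = (V * -a (-1)) * -a (-1 - n) := by
        rw [← h5, ← mul_assoc, ← hVR.symm.mul_pow, hVR.symm.eq, hidem.pow_succ_eq, h5]
      rw [h6]
      refine (norm_mul_le _ _).trans ?_
      rw [norm_neg (a (-1 - n))]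
      have h7 : s ^ (-1 - (n : ℤ)) = s⁻¹ ^ (n + 1) := by
        rw [inv_pow, ← zpow_natCast, ← zpow_neg]; congr 1; push_cast; ring
      have h8 := has (-1 - n)
      rw [h7] at h8
      refine (mul_le_mul_of_nonneg_left h8 (norm_nonneg _)).trans ?_
      rw [← mul_assoc]
      gcongr
      linarith [norm_nonneg (V * -a (-1))]

lemma exists_dual_basis_of_isIdempotentElem {E : Type*} [NormedAddCommGroup E]
    [NormedSpace ℝ E] [CompleteSpace E] {P : E →L[ℝ] E} (hP : IsIdempotentElem P)
    (hPc : IsCompactOperator P) :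
    ∃ (m : ℕ) (y : Fin m → E) (f : Fin m → StrongDual ℝ E),
      (∀ x, P x = ∑ j, f j x • y j) ∧ (∀ j, P (y j) = y j) ∧
      ∀ i j, f i (y j) = if i = j then 1 else 0 := by
  have hPP (x : E) : P (P x) = P x := congrArg (fun Q : E →L[ℝ] E => Q x) hP
  set F : Submodule ℝ E := LinearMap.range (P : E →ₗ[ℝ] E) with hF
  have hPF {x : E} (hx : x ∈ F) : P x = x := by
    obtain ⟨z, rfl⟩ := hx
    exact hPP z
  have hclosed : IsClosed (F : Set E) := by
    have : (F : Set E) = {x | P x = x} := by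
      ext x
      exact ⟨fun hx => hPF hx, fun hx => ⟨x, hx⟩⟩
    rw [this]
    exact isClosed_eq P.continuous continuous_id
  let p : E →L[ℝ] F := P.codRestrict F fun x => ⟨x, rfl⟩
  have hfin : FiniteDimensional ℝ F := by
    refine FiniteDimensional.of_isCompactOperator_id (𝕜 := ℝ) ?_
    have h := (hPc.codRestrict (V := F) (fun x => ⟨x, rfl⟩) hclosed).comp_clm F.subtypeL
    have hid : (id : F → F) = Set.codRestrict P F (fun x => ⟨x, rfl⟩) ∘ F.subtypeL :=
      funext fun x => Subtype.ext (hPF x.2).symm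
    exact hid ▸ h
  let b := Module.finBasis ℝ F
  have hf (j) (x : E) : (((b.coord j).toContinuousLinearMap : StrongDual ℝ F) ∘L p) x =
    b.repr (p x) j := rfl
  refine ⟨_, fun j => b j, fun j => (b.coord j).toContinuousLinearMap ∘L p, fun x => ?_,
    fun j => hPF (b j).2, fun i j => ?_⟩
  · simp only [hf]
    conv_lhs => rw [show P x = (p x : E) from rfl, ← b.sum_repr (p x)]
    simp only [AddSubmonoidClass.coe_finsetSum, Submodule.coe_smul]
  · have : p (b j) = b j := Subtype.ext (hPF (b j).2)
    rw [hf, this, b.repr_self, Finsupp.single_apply]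
    simp only [eq_comm]

section Lattice

section LatticeOrderedGroup

variable {E : Type*} [AddCommGroup E] [Lattice E] [IsOrderedAddMonoid E]

lemma nonneg_of_nonneg_two_pow_nsmul {x : E} (k : ℕ) (hx : 0 ≤ 2 ^ k • x) : 0 ≤ x := by
  induction k with
  | zero => simpa using hx
  | succ k ih =>
    rw [pow_succ, mul_nsmul] at hx
    exact ih (nsmul_two_semiclosed hx)

lemma posPart_inf (x y : E) : (x ⊓ y)⁺ = x⁺ ⊓ y⁺ := by
  let _ := AddCommGroup.toDistribLattice E
  simp only [posPart_def]
  exact sup_inf_right x y 0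

/-- The Riesz decomposition property for finite sums. -/
lemma exists_sum_eq_of_le_sum {κ : Type*} (s : Finset κ) (h : κ → E) (hh : ∀ k, 0 ≤ h k)
    {p : E} (hp : 0 ≤ p) (hps : p ≤ ∑ k ∈ s, h k) :
    ∃ z : κ → E, (∀ k, 0 ≤ z k) ∧ (∀ k, z k ≤ h k) ∧ ∑ k ∈ s, z k = p := by
  classical
  induction s using Finset.induction_on generalizing p with
  | empty =>
    exact ⟨0, fun _ => le_rfl, hh, by simpa using le_antisymm hp (by simpa using hps)⟩
  | insert a s ha ih =>
    rw [Finset.sum_insert ha] at hps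
    have hpa : p - p ⊓ h a = (p - h a) ⊔ 0 := by rw [sub_inf, sub_self, sup_comm]
    obtain ⟨z, hz0, hzh, hz⟩ := ih (p := p - p ⊓ h a) (sub_nonneg.mpr inf_le_left) (by
      rw [hpa]
      exact sup_le (by rwa [sub_le_iff_le_add']) (Finset.sum_nonneg fun k _ => hh k))
    refine ⟨Function.update z a (p ⊓ h a), fun k => ?_, fun k => ?_, ?_⟩
    · rcases eq_or_ne k a with rfl | hk
      · simpa using ⟨hp, hh k⟩
      · simpa [hk] using hz0 k
    · rcases eq_or_ne k a with rfl | hk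
      · simp
      · simpa [hk] using hzh k
    · rw [Finset.sum_insert ha, Function.update_self, Finset.sum_congr rfl fun k hk =>
        Function.update_of_ne (fun h : k = a => ha (h ▸ hk)) _ _, hz]
      abel

lemma exists_matrix_of_sum_eq {α κ : Type*} [Fintype κ] (s : Finset α) (p : α → E)
    (hp : ∀ a, 0 ≤ p a) (h : κ → E) (hh : ∀ k, 0 ≤ h k) (hph : ∑ a ∈ s, p a = ∑ k, h k) :
    ∃ z : α → κ → E, (∀ a k, 0 ≤ z a k) ∧ (∀ a ∈ s, ∑ k, z a k = p a) ∧
      ∀ k, ∑ a ∈ s, z a k = h k := by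
  classical
  induction s using Finset.induction_on generalizing h with
  | empty =>
    refine ⟨0, fun _ _ => le_rfl, by simp, fun k => ?_⟩
    have := (Finset.sum_eq_zero_iff_of_nonneg fun k _ => hh k).mp
      (hph.symm.trans Finset.sum_empty) k (Finset.mem_univ k)
    simp [this]
  | insert a s ha ih =>
    rw [Finset.sum_insert ha] at hph
    obtain ⟨y, hy0, hyh, hy⟩ := exists_sum_eq_of_le_sum Finset.univ h hh (hp a) (by
      rw [← hph]
      exact le_add_of_nonneg_right (Finset.sum_nonneg fun b _ => hp b))
    obtain ⟨z, hz0, hzp, hzh⟩ := ih (fun k => h k - y k) (fun k => sub_nonneg.mpr (hyh k)) (by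
      rw [Finset.sum_sub_distrib, hy, ← hph]
      abel)
    have hne {b} (hb : b ∈ s) : b ≠ a := fun h => ha (h ▸ hb)
    refine ⟨Function.update z a y, fun b k => ?_, fun b hb => ?_, fun k => ?_⟩
    · rcases eq_or_ne b a with rfl | hb
      · simpa using hy0 k
      · simpa [hb] using hz0 b k
    · rcases Finset.mem_insert.mp hb with rfl | hb
      · simpa using hy
      · simpa [hne hb] using hzp b hb
    · rw [Finset.sum_insert ha, Function.update_self, Finset.sum_congr rfl fun b hb => by
        rw [Function.update_of_ne (hne hb)], hzh]
      abel

/-- A common refinement of finitely many finite positive partitions of `u`. -/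
lemma exists_common_refinement [Module ℝ E] {κ : Type*} [Fintype κ] {u : E} (hu : 0 ≤ u) {m : ℕ}
    (h : Fin m → κ → E) (hh : ∀ j k, 0 ≤ h j k) (hsum : ∀ j, ∑ k, h j k = u) :
    ∃ x : (Fin m → κ) → E, (∀ a, 0 ≤ x a) ∧ ∑ a, x a = u ∧ (∀ a j, x a ≤ h j (a j)) ∧
      ∀ j (g : κ → ℝ), ∑ a, g (a j) • x a = ∑ k, g k • h j k := by
  induction m with
  | zero => exact ⟨fun _ => u, fun _ => hu, by simp, fun _ j => j.elim0, fun j => j.elim0⟩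
  | succ m ih =>
    obtain ⟨x, hx0, hxu, hxh, hxg⟩ := ih (fun j => h j.succ) (fun j => hh j.succ)
      fun j => hsum j.succ
    obtain ⟨z, hz0, hzx, hzh⟩ := exists_matrix_of_sum_eq Finset.univ x hx0 (h 0) (hh 0)
      (hxu.trans (hsum 0).symm)
    have hzx' (a) : ∑ k, z a k = x a := hzx a (Finset.mem_univ a)
    have hle (a k) : z a k ≤ x a := by
      rw [← hzx' a]
      exact Finset.single_le_sum (fun k _ => hz0 a k) (Finset.mem_univ k)
    have hle' (a k) : z a k ≤ h 0 k := by
      rw [← hzh k]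
      exact Finset.single_le_sum (f := fun a => z a k) (fun a _ => hz0 a k) (Finset.mem_univ a)
    have hsplit (F : (Fin (m + 1) → κ) → E) :
        ∑ b, F b = ∑ a : Fin m → κ, ∑ k, F (Fin.cons k a) := by
      rw [← (Fin.consEquiv fun _ => κ).sum_comp, Fintype.sum_prod_type_right]
      rfl
    refine ⟨fun b => z (Fin.tail b) (b 0), fun b => hz0 _ _, ?_, fun b j => ?_, fun j g => ?_⟩
    · simp [hsplit, hzx', hxu]
    · cases j using Fin.cases with
      | zero => exact hle' _ _
      | succ j => exact (hle _ _).trans (hxh _ j)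
    · rw [hsplit]
      cases j using Fin.cases with
      | zero =>
        simp only [Fin.tail_cons, Fin.cons_zero]
        rw [Finset.sum_comm]
        simp only [← Finset.smul_sum, hzh]
      | succ j =>
        simp only [Fin.tail_cons, Fin.cons_zero, Fin.cons_succ]
        simp only [← Finset.smul_sum, hzx', hxg]

/-- If `x` is below the positive part of finitely many elements, then it is below the positive part
of a common lower bound of them. -/
lemma exists_le_posPart_of_forall_le {ι : Type*} (s : Finset ι) {x u : E} (hu : x ≤ u⁺)
    (g : ι → E) (hg : ∀ j ∈ s, x ≤ (g j)⁺) : ∃ G ≤ u, (∀ j ∈ s, G ≤ g j) ∧ x ≤ G⁺ := by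
  classical
  induction s using Finset.induction_on with
  | empty => exact ⟨u, le_rfl, by simp, hu⟩
  | insert a s ha ih =>
    obtain ⟨G, hGu, hG, hxG⟩ := ih fun j hj => hg j (Finset.mem_insert_of_mem hj)
    refine ⟨G ⊓ g a, inf_le_left.trans hGu, fun j hj => ?_, ?_⟩
    · rcases Finset.mem_insert.mp hj with rfl | hj
      · exact inf_le_right
      · exact inf_le_left.trans (hG j hj)
    · rw [posPart_inf]
      exact le_inf hxG (hg a (Finset.mem_insert_self a s))

end LatticeOrderedGroup

variable {E : Type*} [NormedAddCommGroup E] [Lattice E] [HasSolidNorm E] [IsOrderedAddMonoid E]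

lemma norm_le_norm_of_nonneg_of_le {x y : E} (hx : 0 ≤ x) (hxy : x ≤ y) : ‖x‖ ≤ ‖y‖ :=
  norm_le_norm_of_abs_le_abs (by rwa [abs_of_nonneg hx, abs_of_nonneg (hx.trans hxy)])

lemma norm_posPart_le (x : E) : ‖x⁺‖ ≤ ‖x‖ := by
  rw [← norm_abs_eq_norm x]
  exact norm_le_norm_of_nonneg_of_le (posPart_nonneg x) (sup_le (le_abs_self x) (abs_nonneg x))

variable [NormedSpace ℝ E]

/-- In a Banach lattice, multiplication by nonnegative scalars preserves order: the additive
structure and the closedness of the positive cone force it. -/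
instance HasSolidNorm.posSMulMono_real : PosSMulMono ℝ E := by
  refine PosSMulMono.of_smul_nonneg fun c hc x hx => ?_
  have hdyadic (k : ℕ) : 0 ≤ ((⌊c * 2 ^ k⌋₊ : ℝ) / 2 ^ k) • x := by
    refine nonneg_of_nonneg_two_pow_nsmul k ?_
    have : 2 ^ k • ((⌊c * 2 ^ k⌋₊ : ℝ) / 2 ^ k) • x = ⌊c * 2 ^ k⌋₊ • x := by
      rw [← Nat.cast_smul_eq_nsmul ℝ, ← Nat.cast_smul_eq_nsmul ℝ, smul_smul]
      congr 1
      push_cast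
      field_simp
    rw [this]
    exact nsmul_nonneg hx _
  have hlim : Tendsto (fun k : ℕ => ((⌊c * 2 ^ k⌋₊ : ℝ) / 2 ^ k) • x) atTop (𝓝 (c • x)) :=
    ((tendsto_nat_floor_mul_div_atTop hc).comp
      (tendsto_pow_atTop_atTop_of_one_lt (one_lt_two (α := ℝ)))).smul_const x
  exact ge_of_tendsto' hlim hdyadic

lemma posPart_smul_of_pos {c : ℝ} (hc : 0 < c) (x : E) : (c • x)⁺ = c • x⁺ := by
  have := (OrderIso.smulRight (β := E) hc).map_sup x 0
  rw [OrderIso.smulRight_apply, OrderIso.smulRight_apply, OrderIso.smulRight_apply,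
    smul_zero] at this
  exact this.symm

lemma exists_nonneg_functional (w : E) :
    ∃ φ : StrongDual ℝ E, (∀ x, 0 ≤ x → 0 ≤ φ x) ∧ ‖φ‖ ≤ 1 ∧ φ w = ‖w⁺‖ := by
  by_cases hw : w = 0
  · exact ⟨0, by simp, by simp, by simp [hw]⟩
  obtain ⟨g, hg1, hg2⟩ := exists_extension_of_le_sublinear
    (LinearPMap.mkSpanSingleton w ‖w⁺‖ hw : E →ₗ.[ℝ] ℝ) (fun x => ‖x⁺‖)
    (fun c hc x => by
      simp only [posPart_smul_of_pos hc, norm_smul, Real.norm_of_nonneg hc.le])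
    (fun x y => (norm_le_norm_of_nonneg_of_le (posPart_nonneg _)
      (sup_le (add_le_add le_sup_left le_sup_left)
        (add_nonneg (posPart_nonneg x) (posPart_nonneg y)))).trans (norm_add_le _ _))
    (fun ⟨x, hx⟩ => by
      obtain ⟨c, rfl⟩ := Submodule.mem_span_singleton.mp hx
      have hval : LinearPMap.mkSpanSingleton w ‖w⁺‖ hw ⟨c • w, hx⟩ = c • ‖w⁺‖ :=
        LinearPMap.mkSpanSingleton'_apply _ _ _ _ _
      rw [hval]
      rcases lt_or_ge 0 c with hc | hc
      · simp [posPart_smul_of_pos hc, norm_smul, abs_of_pos hc]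
      · exact (smul_nonpos_of_nonpos_of_nonneg hc (norm_nonneg _)).trans (norm_nonneg _))
  have hg (x : E) : |g x| ≤ 1 * ‖x‖ := by
    rw [one_mul, abs_le', ← map_neg, ← norm_neg x]
    exact ⟨((hg2 x).trans (norm_posPart_le x)).trans_eq (norm_neg x).symm,
      (hg2 (-x)).trans (norm_posPart_le (-x))⟩
  refine ⟨g.mkContinuous 1 hg, fun x hx => ?_, g.mkContinuous_norm_le zero_le_one hg, ?_⟩
  · have := hg2 (-x)
    rw [posPart_eq_zero.mpr (neg_nonpos.mpr hx), norm_zero, map_neg] at this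
    simpa using this
  · have := hg1 ⟨w, Submodule.mem_span_singleton_self w⟩
    rwa [LinearPMap.mkSpanSingleton_apply] at this

/-- A `u`-bounded element is a combination of a partition of `u` into pieces on which it is nearly
constant. -/
lemma exists_partition_of_abs_le {u y : E} (hy : |y| ≤ u) {K : ℕ} (hK : 0 < K) :
    ∃ h : Fin (2 * K + 1) → E, (∀ k, 0 ≤ h k) ∧ ∑ k, h k = u ∧
      ∑ k : Fin (2 * K + 1), ((k : ℝ) / K - 1) • h k = y ∧
      ∀ k : Fin (2 * K + 1), h k ≤ u ∧
        h k ≤ (u - (K : ℝ) • (y - ((k : ℝ) / K - 1) • u))⁺ ∧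
        h k ≤ (u + (K : ℝ) • (y - ((k : ℝ) / K - 1) • u))⁺ := by
  have hu : 0 ≤ u := (abs_nonneg y).trans hy
  obtain ⟨hy1, hy2⟩ := abs_le'.mp hy
  have hKR : (0 : ℝ) < K := by exact_mod_cast hK
  set z := (K : ℝ) • (y + u) with hz
  have hz0 : 0 ≤ z := smul_nonneg hKR.le (by simpa [neg_le_iff_add_nonneg'] using hy2)
  have hz1 : z ≤ ((2 * K : ℕ) : ℝ) • u := by
    have : ((2 * K : ℕ) : ℝ) • u = (K : ℝ) • (u + u) := by
      rw [← two_smul ℝ u, smul_smul]; push_cast; ring_nf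
    rw [this]
    exact smul_le_smul_of_nonneg_left (add_le_add hy1 le_rfl) hKR.le
  have hzv (k : ℕ) : (K : ℝ) • (y - ((k : ℝ) / K - 1) • u) = z - (k : ℝ) • u := by
    rw [hz, smul_sub, smul_smul, mul_sub, mul_div_cancel₀ _ hKR.ne', sub_smul, mul_one, smul_add]
    abel
  obtain ⟨s, hs⟩ : ∃ s : ℕ → E, s = fun k : ℕ => (z - (k : ℝ) • u + u)⁺ ⊓ u := ⟨_, rfl⟩
  have hs0 : s 0 = u := by
    rw [hs]
    exact inf_eq_right.mpr (le_trans (by simpa using hz0) (le_posPart _))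
  have hsucc (k : ℕ) : s (k + 1) = (z - (k : ℝ) • u)⁺ ⊓ u := by
    rw [hs]
    simp [add_smul, sub_add_eq_sub_sub]
  have hslast : s (2 * K + 1) = 0 := by
    rw [hsucc, posPart_eq_zero.mpr (sub_nonpos.mpr hz1), inf_eq_left.mpr hu]
  have hs_nonneg (k : ℕ) : 0 ≤ s k := by
    rw [hs]
    exact le_inf (posPart_nonneg _) hu
  have hanti (k : ℕ) : s (k + 1) ≤ s k := by
    rw [hsucc, hs]
    exact inf_le_inf_right _ (posPart_mono (le_add_of_nonneg_right hu))
  have htel (k : ℕ) : ∑ i ∈ Finset.range k, s (i + 1) = z ⊓ (k : ℝ) • u := by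
    induction k with
    | zero => simpa using hz0
    | succ k ih =>
      have h1 : ((z - (k : ℝ) • u)⁺ - u)⁺ = (z - (k : ℝ) • u - u)⁺ := by
        simp only [posPart_def, sup_sub, sup_assoc, zero_sub]
        rw [sup_eq_right.mpr (neg_nonpos.mpr hu)]
      rw [Finset.sum_range_succ, ih, hsucc, inf_eq_sub_posPart_sub, inf_eq_sub_posPart_sub, h1,
        inf_eq_sub_posPart_sub, Nat.cast_succ, add_smul, one_smul, sub_add_eq_sub_sub z]
      abel
  have habel (n : ℕ) : ∑ k ∈ Finset.range n, (k : ℝ) • (s k - s (k + 1)) =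
      ∑ k ∈ Finset.range n, s (k + 1) - (n : ℝ) • s n := by
    induction n with
    | zero => simp
    | succ n ih =>
      rw [Finset.sum_range_succ, ih, Finset.sum_range_succ]
      push_cast
      module
  have hsum : ∑ k : Fin (2 * K + 1), (s k - s (k + 1)) = u := by
    rw [Fin.sum_univ_eq_sum_range (fun k => s k - s (k + 1)), Finset.sum_range_sub', hs0, hslast,
      sub_zero]
  refine ⟨fun k => s k - s (k + 1), fun k => sub_nonneg.mpr (hanti k), hsum, ?_, fun k => ?_⟩
  · have h1 : ∑ k : Fin (2 * K + 1), (k : ℝ) • (s k - s (k + 1)) = z := by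
      rw [Fin.sum_univ_eq_sum_range (fun k => (k : ℝ) • (s k - s (k + 1))), habel, htel, hslast,
        smul_zero, sub_zero, inf_eq_left]
      refine hz1.trans (smul_le_smul_of_nonneg_right ?_ hu)
      exact_mod_cast Nat.le_succ _
    simp only [sub_smul, one_smul, Finset.sum_sub_distrib]
    rw [← Finset.sum_sub_distrib, hsum]
    simp only [div_eq_inv_mul, mul_smul, ← Finset.smul_sum, h1]
    rw [hz, inv_smul_smul₀ hKR.ne', add_sub_cancel_right]
  · rw [hzv]
    refine ⟨(sub_le_self _ (hs_nonneg _)).trans (by rw [hs]; exact inf_le_right), ?_, ?_⟩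
    · refine (sub_le_sub_right (b := u) (by rw [hs]; exact inf_le_right) _).trans ?_
      rw [hsucc, sub_inf, sub_self]
      exact sup_le ((sub_le_sub_left (le_posPart _) _).trans (le_posPart _)) (posPart_nonneg _)
    · refine (sub_le_self _ (hs_nonneg _)).trans ?_
      rw [hs, add_comm u]
      exact inf_le_left

/-- Functionals attached to a cell of the partition: `φ` is normalised by `φ u ≤ 1` and sends each
`y j` close to `c j * φ u`. -/
lemma exists_cell_functional {ι : Type*} [Fintype ι] {x u : E} (hx : 0 ≤ x) (hxu : x ≤ u)
    (v : ι → E) (hv : ∀ j, x ≤ (u - v j)⁺ ∧ x ≤ (u + v j)⁺) :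
    ∃ φ : StrongDual ℝ E, (∀ w, 0 ≤ w → 0 ≤ φ w) ∧ ‖φ‖ * ‖x‖ ≤ 1 ∧ φ u ≤ 1 ∧
      (φ u) • x = x ∧ ∀ j, |φ (v j)| ≤ 1 := by
  by_cases hx0 : x = 0
  · exact ⟨0, by simp, by simp, by simp, by simp [hx0], by simp⟩
  obtain ⟨G, hGu, hG, hxG⟩ := exists_le_posPart_of_forall_le Finset.univ
    (hxu.trans (le_posPart u)) (fun p : ι × Bool => if p.2 then u - v p.1 else u + v p.1)
    (x := x) (by rintro ⟨j, b⟩ -; cases b <;> simp [hv j])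
  obtain ⟨φ, hφ0, hφ1, hφG⟩ := exists_nonneg_functional G
  have hmono {w w' : E} (h : w ≤ w') : φ w ≤ φ w' := by
    simpa using hφ0 _ (sub_nonneg.mpr h)
  have hGx : ‖x‖ ≤ φ G := hφG ▸ norm_le_norm_of_nonneg_of_le hx hxG
  have hx' : 0 < ‖x‖ := norm_pos_iff.mpr hx0
  have hGu' := hmono hGu
  have hφu : 0 < φ u := by linarith
  refine ⟨(φ u)⁻¹ • φ, fun w hw => mul_nonneg (inv_nonneg.mpr hφu.le) (hφ0 w hw), ?_, ?_, ?_,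
    fun j => ?_⟩
  · rw [norm_smul, Real.norm_of_nonneg (inv_nonneg.mpr hφu.le), mul_assoc,
      inv_mul_le_iff₀ hφu, mul_one]
    calc ‖φ‖ * ‖x‖ ≤ 1 * ‖x‖ := by gcongr
      _ ≤ φ u := by linarith
  · simp [hφu.ne']
  · simp [hφu.ne']
  · have h1 := hmono (hG (j, true) (Finset.mem_univ _))
    have h2 := hmono (hG (j, false) (Finset.mem_univ _))
    simp only [if_true, Bool.false_eq_true, if_false, map_sub, map_add] at h1 h2
    rw [smul_apply, smul_eq_mul, abs_mul, abs_of_pos (inv_pos.mpr hφu),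
      inv_mul_le_iff₀ hφu, mul_one, abs_le]
    constructor <;> linarith

lemma abs_sum_smul_le {α : Type*} (s : Finset α) (c : α → ℝ) (x : α → E) {r : ℝ}
    (hx : ∀ a ∈ s, 0 ≤ x a) (hc : ∀ a ∈ s, |c a| ≤ r) : |∑ a ∈ s, c a • x a| ≤ r • ∑ a ∈ s, x a := by
  rw [abs_le', ← Finset.sum_neg_distrib, Finset.smul_sum]
  refine ⟨Finset.sum_le_sum fun a ha =>
    smul_le_smul_of_nonneg_right ((le_abs_self _).trans (hc a ha)) (hx a ha),
    Finset.sum_le_sum fun a ha => ?_⟩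
  rw [← neg_smul]
  exact smul_le_smul_of_nonneg_right ((neg_le_abs _).trans (hc a ha)) (hx a ha)

/-- Positive finite rank operators that nearly fix finitely many given elements, with control on
the number and on the norms of the rank one terms. -/
lemma exists_finite_rank_approximation {ι : Type*} [Fintype ι] {u : E} (hu : 0 ≤ u) (y : ι → E)
    (hy : ∀ j, |y j| ≤ u) {K : ℕ} (hK : 0 < K) :
    ∃ (α : Type) (_ : Fintype α) (x : α → E) (φ : α → StrongDual ℝ E),
      Fintype.card α = (2 * K + 1) ^ Fintype.card ι ∧ (∀ a, 0 ≤ x a) ∧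
      (∀ a w, 0 ≤ w → 0 ≤ φ a w) ∧ (∀ a, ‖φ a‖ * ‖x a‖ ≤ 1) ∧
      (∀ w, |w| ≤ u → ‖∑ a, φ a w • x a‖ ≤ ‖u‖) ∧
      ∀ j, ‖∑ a, φ a (y j) • x a - y j‖ ≤ ‖u‖ / K := by
  have hKR : (0 : ℝ) < K := by exact_mod_cast hK
  let e := Fintype.equivFin ι
  choose h hh0 hhu hhy hhk using fun j => exists_partition_of_abs_le (hy (e.symm j)) hK
  obtain ⟨x, hx0, hxu, hxh, hxg⟩ := exists_common_refinement hu h hh0 hhu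
  have hx_le (a) : x a ≤ u := by
    rw [← hxu]
    exact Finset.single_le_sum (fun a _ => hx0 a) (Finset.mem_univ a)
  choose φ hφ0 hφn hφ1 hφx hφv using fun a => exists_cell_functional (hx0 a) (hx_le a)
    (fun j => (K : ℝ) • (y (e.symm j) - ((a j : ℝ) / K - 1) • u)) fun j =>
      ⟨(hxh a j).trans (hhk j (a j)).2.1, (hxh a j).trans (hhk j (a j)).2.2⟩
  refine ⟨_, inferInstance, x, φ, by simp, hx0, hφ0, hφn, fun w hw => ?_, fun j => ?_⟩
  · refine norm_le_norm_of_abs_le_abs ?_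
    rw [abs_of_nonneg hu]
    refine (abs_sum_smul_le Finset.univ _ x (fun a _ => hx0 a) fun a _ => ?_).trans_eq
      ((one_smul ℝ _).trans hxu)
    obtain ⟨hw1, hw2⟩ := abs_le'.mp hw
    have h1 := hφ0 a _ (sub_nonneg.mpr hw1)
    have h2 := hφ0 a _ (sub_nonneg.mpr hw2)
    rw [map_sub] at h1 h2
    rw [map_neg] at h2
    exact abs_le.mpr ⟨by linarith [hφ1 a], by linarith [hφ1 a]⟩
  · have heq : ∑ a, φ a (y j) • x a - y j =
        ∑ a, (φ a (y j - ((a (e j) : ℝ) / K - 1) • u)) • x a := by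
      have h1 := hxg (e j) fun k => (k : ℝ) / K - 1
      rw [hhy, e.symm_apply_apply] at h1
      simp only [map_sub, map_smul, smul_eq_mul, sub_smul _ _ (_ : E), mul_smul, hφx,
        Finset.sum_sub_distrib]
      rw [← h1]
      simp only [sub_smul, Finset.sum_sub_distrib]
    have h2 : ‖(K : ℝ)⁻¹ • u‖ = (K : ℝ)⁻¹ * ‖u‖ := by
      rw [norm_smul, Real.norm_of_nonneg (by positivity)]
    rw [heq, div_eq_inv_mul, ← h2]
    refine norm_le_norm_of_abs_le_abs ?_
    rw [abs_of_nonneg (smul_nonneg (by positivity) hu), ← hxu]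
    refine abs_sum_smul_le Finset.univ _ x (fun a _ => hx0 a) fun a _ => ?_
    have h3 := hφv a (e j)
    rw [e.symm_apply_apply, map_smul, smul_eq_mul, abs_mul, abs_of_pos hKR] at h3
    rwa [← mul_one (K : ℝ)⁻¹, le_inv_mul_iff₀ hKR, hxu]

end Lattice

section Trace

variable {E : Type*} [NormedAddCommGroup E] [NormedSpace ℝ E]

lemma sum_apply_finite_rank {α ι : Type*} [Fintype α] [Fintype ι] (x : α → E)
    (φ : α → StrongDual ℝ E) (f : ι → StrongDual ℝ E) (y : ι → E) (L W : E →L[ℝ] E)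
    (hL : ∀ w, L w = ∑ j, f j (W w) • y j) :
    ∑ a, φ a (L (x a)) = ∑ j, f j (W (∑ a, φ a (y j) • x a)) := by
  simp only [hL, map_sum, map_smul, smul_eq_mul]
  rw [Finset.sum_comm]
  exact Finset.sum_congr rfl fun _ _ => Finset.sum_congr rfl fun _ _ => mul_comm _ _

lemma abs_sum_apply_le {ι : Type*} [Fintype ι] (f : ι → StrongDual ℝ E) (W : E →L[ℝ] E)
    (w : ι → E) {r : ℝ} (hw : ∀ j, ‖w j‖ ≤ r) :
    |∑ j, f j (W (w j))| ≤ (∑ j, ‖f j‖) * (‖W‖ * r) := by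
  rw [Finset.sum_mul]
  refine (Finset.abs_sum_le_sum_abs _ _).trans (Finset.sum_le_sum fun j _ => ?_)
  refine ((f j).le_opNorm _).trans (mul_le_mul_of_nonneg_left ?_ (norm_nonneg _))
  exact (W.le_opNorm _).trans (mul_le_mul_of_nonneg_left (hw j) (norm_nonneg _))

lemma abs_sum_apply_sub_le {α ι κ : Type*} [Fintype α] [Fintype ι] [Fintype κ]
    {V P P' : E →L[ℝ] E} {f : ι → StrongDual ℝ E} {y : ι → E} {g : κ → StrongDual ℝ E} {z : κ → E}
    (hP : ∀ w, P w = ∑ j, f j w • y j) (hP' : ∀ w, P' w = ∑ l, g l w • z l)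
    (hVP : Commute V P) (x : α → E) (φ : α → StrongDual ℝ E) (hφ : ∀ a, ‖φ a‖ * ‖x a‖ ≤ 1)
    {η r : ℝ} (hy : ∀ j, ‖∑ a, φ a (y j) • x a - y j‖ ≤ η)
    (hz : ∀ l, ‖∑ a, φ a (z l) • x a‖ ≤ r) (n : ℕ) :
    |∑ a, φ a ((V ^ n) (x a)) - ∑ j, f j ((V ^ n) (y j))| ≤
      (∑ j, ‖f j‖) * (‖V ^ n‖ * η) + (∑ l, ‖g l‖) * (‖V ^ n * (1 - P)‖ * r) +
        Fintype.card α * (‖(1 - P') * V ^ n‖ * ‖1 - P‖) := by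
  have hdecomp : V ^ n = P * V ^ n + P' * (V ^ n * (1 - P)) + (1 - P') * V ^ n * (1 - P) := by
    rw [← (hVP.pow_left n).eq]
    noncomm_ring
  have h1 : ∑ a, φ a ((P * V ^ n) (x a)) - ∑ j, f j ((V ^ n) (y j)) =
      ∑ j, f j ((V ^ n) (∑ a, φ a (y j) • x a - y j)) := by
    rw [sum_apply_finite_rank x φ f y (P * V ^ n) (V ^ n) fun w => hP _]
    simp only [map_sub, Finset.sum_sub_distrib]
  have h2 := sum_apply_finite_rank x φ g z (P' * (V ^ n * (1 - P))) (V ^ n * (1 - P)) fun w =>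
    hP' _
  have h3 : |∑ a, φ a (((1 - P') * V ^ n * (1 - P)) (x a))| ≤
      Fintype.card α * (‖(1 - P') * V ^ n‖ * ‖1 - P‖) := by
    refine (Finset.abs_sum_le_sum_abs _ _).trans
      ((Finset.sum_le_card_nsmul _ _ _ fun a _ => ?_).trans_eq (nsmul_eq_mul _ _))
    refine ((φ a).le_opNorm _).trans ((mul_le_mul_of_nonneg_left
      ((((1 - P') * V ^ n * (1 - P)).le_opNorm _).trans (mul_le_mul_of_nonneg_right
        (norm_mul_le _ _) (norm_nonneg _))) (norm_nonneg _)).trans ?_)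
    calc _ = (‖(1 - P') * V ^ n‖ * ‖1 - P‖) * (‖φ a‖ * ‖x a‖) := by ring
      _ ≤ (‖(1 - P') * V ^ n‖ * ‖1 - P‖) * 1 := by gcongr; exact hφ a
      _ = _ := mul_one _
  have hsplit : ∑ a, φ a ((V ^ n) (x a)) - ∑ j, f j ((V ^ n) (y j)) =
      ∑ j, f j ((V ^ n) (∑ a, φ a (y j) • x a - y j)) +
      ∑ l, g l ((V ^ n * (1 - P)) (∑ a, φ a (z l) • x a)) +
      ∑ a, φ a (((1 - P') * V ^ n * (1 - P)) (x a)) := by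
    rw [← h1, ← h2]
    have hterm (a : α) : φ a ((V ^ n) (x a)) = φ a ((P * V ^ n) (x a)) +
        φ a ((P' * (V ^ n * (1 - P))) (x a)) + φ a (((1 - P') * V ^ n * (1 - P)) (x a)) := by
      conv_lhs => rw [hdecomp]
      simp only [add_apply, map_add]
    simp only [hterm, Finset.sum_add_distrib]
    ring
  rw [hsplit]
  exact (abs_add_three _ _ _).trans (add_le_add (add_le_add (abs_sum_apply_le f _ _ hy)
    (abs_sum_apply_le g _ _ hz)) h3)

lemma exists_finite_rank_norm_mul_pow_le [CompleteSpace E] {V : E →L[ℝ] E}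
    (hV : IsCompactOperator V) {ε : ℝ} (hε : 0 < ε) :
    ∃ (m : ℕ) (z : Fin m → E) (g : Fin m → StrongDual ℝ E) (P : E →L[ℝ] E) (C : ℝ),
      (∀ w, P w = ∑ l, g l w • z l) ∧ 0 ≤ C ∧ ∀ n : ℕ, ‖(1 - P) * V ^ n‖ ≤ C * ε ^ n := by
  obtain ⟨t, s, K, R, ht, hts, hsε, hVR, hRVR, hK, -⟩ := exists_riesz_decomposition hV hε
  have hidem : IsIdempotentElem (V * R) := by
    rw [IsIdempotentElem, mul_assoc, ← mul_assoc R, hRVR]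
  obtain ⟨m, z, g, hP, -⟩ := exists_dual_basis_of_isIdempotentElem hidem (hV.comp_clm R)
  have hK0 : 0 ≤ K := by simpa using (norm_nonneg _).trans (hK 0)
  refine ⟨m, z, g, V * R, K, hP, hK0, fun n => ?_⟩
  have hcomm : Commute (1 - V * R) (V ^ n) :=
    ((Commute.one_right V).sub_right ((Commute.refl V).mul_right hVR)).symm.pow_right n
  rw [hcomm.eq]
  refine (hK n).trans ?_
  gcongr
  linarith

end Trace

section LatticeTrace

variable {E : Type*} [NormedAddCommGroup E] [Lattice E] [HasSolidNorm E] [IsOrderedAddMonoid E]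
  [NormedSpace ℝ E] [CompleteSpace E]

/-- Finitely many compact operators have common positive approximate traces, which agree with the
traces on given spectral subspaces up to the decay rate on the complementary subspaces. -/
lemma exists_positive_approximate_trace {I : Type*} [Fintype I] {V P : I → E →L[ℝ] E}
    (hV : ∀ i, IsCompactOperator (V i)) {m : I → ℕ} {f : ∀ i, Fin (m i) → StrongDual ℝ E}
    {y : ∀ i, Fin (m i) → E} (hP : ∀ i w, P i w = ∑ j, f i j w • y i j)
    (hVP : ∀ i, Commute (V i) (P i)) {t : ℝ} (ht : 0 < t) {C : I → ℝ}
    (hC : ∀ i (n : ℕ), ‖V i ^ n * (1 - P i)‖ ≤ C i * t ^ n) :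
    ∃ D : ℝ, ∀ n : ℕ, ∃ (α : Type) (_ : Fintype α) (x : α → E) (φ : α → StrongDual ℝ E),
      (∀ a, 0 ≤ x a) ∧ (∀ a w, 0 ≤ w → 0 ≤ φ a w) ∧
      ∀ i, |∑ a, φ a ((V i ^ n) (x a)) - ∑ j, f i j ((V i ^ n) (y i j))| ≤ D * t ^ n := by
  classical
  have hC0 (i) : 0 ≤ C i := by simpa using (norm_nonneg _).trans (hC i 0)
  obtain ⟨q, hq1, hq⟩ : ∃ q : ℕ, 1 ≤ q ∧ ∀ i, ‖V i‖ ≤ t * q := by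
    refine ⟨⌈(∑ i, ‖V i‖) / t⌉₊ + 1, by lia, fun i => ?_⟩
    rw [← div_le_iff₀' ht]
    calc ‖V i‖ / t ≤ (∑ i, ‖V i‖) / t := by
          gcongr
          exact Finset.single_le_sum (fun i _ => norm_nonneg (V i)) (Finset.mem_univ i)
      _ ≤ ⌈(∑ i, ‖V i‖) / t⌉₊ := Nat.le_ceil _
      _ ≤ _ := by push_cast; linarith
  have hq0 : (0 : ℝ) < q := by exact_mod_cast hq1
  let ι := Σ i, Fin (m i)
  set M := Fintype.card ι with hM
  have hε : 0 < t / (q : ℝ) ^ M := by positivity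
  choose k z g P' C' hP' hC' hC'n using fun i => exists_finite_rank_norm_mul_pow_le (hV i) hε
  set u : E := ∑ p : ι, |y p.1 p.2| + ∑ p : Σ i, Fin (k i), |z p.1 p.2| with hu_def
  have hy0 : 0 ≤ ∑ p : ι, |y p.1 p.2| := Finset.sum_nonneg fun _ _ => abs_nonneg _
  have hz0 : 0 ≤ ∑ p : Σ i, Fin (k i), |z p.1 p.2| := Finset.sum_nonneg fun _ _ => abs_nonneg _
  have hyu (p : ι) : |y p.1 p.2| ≤ u :=
    (Finset.single_le_sum (f := fun p : ι => |y p.1 p.2|) (fun _ _ => abs_nonneg _)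
      (Finset.mem_univ p)).trans (le_add_of_nonneg_right hz0)
  have hzu (p : Σ i, Fin (k i)) : |z p.1 p.2| ≤ u :=
    (Finset.single_le_sum (f := fun p : Σ i, Fin (k i) => |z p.1 p.2|) (fun _ _ => abs_nonneg _)
      (Finset.mem_univ p)).trans (le_add_of_nonneg_left hy0)
  have hu : 0 ≤ u := add_nonneg hy0 hz0
  let D (i : I) : ℝ := (∑ j, ‖f i j‖) * ‖u‖ + (∑ l, ‖g i l‖) * (C i * ‖u‖) +
    3 ^ M * (C' i * ‖1 - P i‖)
  have hD0 (i) : 0 ≤ D i := by have := hC0 i; have := hC' i; positivity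
  refine ⟨∑ i, D i, fun n => ?_⟩
  obtain ⟨α, hα, x, φ, hcard, hx, hφ, hφx, hQ, hQy⟩ :=
    exists_finite_rank_approximation hu (fun p : ι => y p.1 p.2) hyu (pow_pos hq1 n)
  refine ⟨α, hα, x, φ, hx, hφ, fun i => ?_⟩
  have hmain := abs_sum_apply_sub_le (hP i) (hP' i) (hVP i) x φ hφx (fun j => hQy ⟨i, j⟩)
    (fun l => hQ _ (hzu ⟨i, l⟩)) n
  have h1 : ‖V i ^ n‖ * (‖u‖ / (q ^ n : ℕ)) ≤ ‖u‖ * t ^ n := by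
    have : ‖V i ^ n‖ ≤ t ^ n * (q : ℝ) ^ n := by
      rw [← mul_pow]
      refine le_trans ?_ (pow_le_pow_left₀ (norm_nonneg _) (hq i) n)
      rcases n.eq_zero_or_pos with rfl | hn
      · rw [pow_zero, pow_zero]
        exact ContinuousLinearMap.norm_id_le
      · exact norm_pow_le' _ hn
    push_cast
    rw [mul_div_assoc', div_le_iff₀ (by positivity)]
    calc _ ≤ t ^ n * (q : ℝ) ^ n * ‖u‖ := by gcongr
      _ = _ := by ring
  have h2 : ‖V i ^ n * (1 - P i)‖ * ‖u‖ ≤ (C i * ‖u‖) * t ^ n := by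
    calc _ ≤ C i * t ^ n * ‖u‖ := by gcongr; exact hC i n
      _ = _ := by ring
  have h3 : (Fintype.card α : ℝ) * (‖(1 - P' i) * V i ^ n‖ * ‖1 - P i‖) ≤
      3 ^ M * (C' i * ‖1 - P i‖) * t ^ n := by
    have h4 : (Fintype.card α : ℝ) ≤ 3 ^ M * ((q : ℝ) ^ M) ^ n := by
      rw [hcard, ← hM]
      push_cast
      rw [← pow_mul, mul_comm M n, pow_mul, ← mul_pow]
      have : (1 : ℝ) ≤ (q : ℝ) ^ n := one_le_pow₀ (by exact_mod_cast hq1)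
      gcongr
      linarith
    calc _ ≤ 3 ^ M * ((q : ℝ) ^ M) ^ n * (C' i * (t / (q : ℝ) ^ M) ^ n * ‖1 - P i‖) := by
          gcongr
          exact hC'n i n
      _ = _ := by
          rw [div_pow]
          field_simp
  calc _ ≤ _ := hmain
    _ ≤ (∑ j, ‖f i j‖) * (‖u‖ * t ^ n) + (∑ l, ‖g i l‖) * ((C i * ‖u‖) * t ^ n) +
        3 ^ M * (C' i * ‖1 - P i‖) * t ^ n := by gcongr
    _ = D i * t ^ n := by ring
    _ ≤ _ := by
      gcongr
      exact Finset.single_le_sum (fun i _ => hD0 i) (Finset.mem_univ i)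

end LatticeTrace

lemma exists_bound_on_finiteDimensional {X ι : Type*} [NormedAddCommGroup X] [NormedSpace ℝ X]
    (W : Submodule ℝ X) [FiniteDimensional ℝ W] (g : ι → StrongDual ℝ X)
    (h : ∀ w ∈ W, ∃ B, ∀ n, |g n w| ≤ B) : ∃ B, 0 ≤ B ∧ ∀ n, ∀ w ∈ W, |g n w| ≤ B * ‖w‖ := by
  have : CompleteSpace W := FiniteDimensional.complete ℝ W
  obtain ⟨B, hB⟩ := banach_steinhaus (g := fun n => g n ∘L W.subtypeL) fun w => h w w.2
  refine ⟨max B 0, le_max_right _ _, fun n w hw => ?_⟩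
  exact ((g n ∘L W.subtypeL).le_of_opNorm_le ((hB n).trans (le_max_left _ _)) ⟨w, hw⟩)

/-- If the traces of the powers of `U` on a spectral subspace decay faster than the inverse of `U`
on that subspace grows, then the subspace is trivial. -/
lemma mul_eq_zero_of_abs_trace_pow_le {E : Type*} [NormedAddCommGroup E] [NormedSpace ℝ E]
    {U R : E →L[ℝ] E} (hUR : Commute U R) (hRUR : R * U * R = R) {m : ℕ} {y : Fin m → E}
    {f : Fin m → StrongDual ℝ E} (hP : ∀ x, (U * R) x = ∑ j, f j x • y j)
    (hPy : ∀ j, (U * R) (y j) = y j) (hfy : ∀ i j, f i (y j) = if i = j then 1 else 0)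
    {t s K D : ℝ} (ht : 0 < t) (hts : t < s) (hR : ∀ n : ℕ, ‖R ^ n * (U * R)‖ ≤ K * s⁻¹ ^ n)
    (hD : ∀ n : ℕ, |∑ j, f j ((U ^ n) (y j))| ≤ D * t ^ n) : U * R = 0 := by
  have hs : 0 < s := ht.trans hts
  obtain ⟨P, hP_def⟩ : ∃ P, P = U * R := ⟨_, rfl⟩
  simp only [← hP_def] at hP hPy hR ⊢
  have hidem : P * P = P := by rw [hP_def, mul_assoc, ← mul_assoc R, hRUR]
  have hRU : R * U = P := hUR.eq.symm.trans hP_def.symm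
  have hUP : Commute U P := hP_def ▸ (Commute.refl U).mul_right hUR
  let W : Submodule ℝ (E →L[ℝ] E) := Submodule.span ℝ (Set.range fun i : ℕ => U ^ i * P)
  have hgen (i : ℕ) : U ^ i * P ∈ W := Submodule.subset_span ⟨i, rfl⟩
  have hfin : FiniteDimensional ℝ W := by
    let W' : Submodule ℝ (E →L[ℝ] E) :=
      Submodule.span ℝ (Set.range fun p : Fin m × Fin m => (f p.1).smulRight (y p.2))
    have : FiniteDimensional ℝ W' := FiniteDimensional.span_of_finite ℝ (Set.finite_range _)
    refine Submodule.finiteDimensional_of_le (S₂ := W') (Submodule.span_le.mpr ?_)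
    rintro _ ⟨i, rfl⟩
    have heq : U ^ i * P = ∑ j, ∑ k, f k ((U ^ i) (y j)) • (f j).smulRight (y k) := by
      ext x
      have h1 (j) : (U ^ i) (y j) = ∑ k, f k ((U ^ i) (y j)) • y k := by
        rw [← hP]
        have := congrArg (fun Z : E →L[ℝ] E => Z (y j)) (hUP.pow_left i).eq
        rw [mul_apply_eq_comp, mul_apply_eq_comp, hPy] at this
        exact this
      rw [mul_apply_eq_comp, hP]
      simp only [map_sum, map_smul, sum_apply, smul_apply, ContinuousLinearMap.smulRight_apply]
      refine Finset.sum_congr rfl fun j _ => ?_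
      conv_lhs => rw [h1, Finset.smul_sum]
      exact Finset.sum_congr rfl fun k _ => smul_comm _ _ _
    simp only [heq]
    exact Submodule.sum_mem _ fun j _ => Submodule.sum_mem _ fun k _ =>
      W'.smul_mem _ (Submodule.subset_span ⟨(j, k), rfl⟩)
  have hPW {w : E →L[ℝ] E} (hw : w ∈ W) : P * w = w := by
    induction hw using Submodule.span_induction with
    | mem w hw =>
      obtain ⟨i, rfl⟩ := hw
      simp only
      rw [← mul_assoc, ← (hUP.pow_left i).eq, mul_assoc, hidem]
    | zero => simp
    | add v w _ _ hv hw => rw [mul_add, hv, hw]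
    | smul c w _ hw => rw [mul_smul_comm, hw]
  have hUW {w : E →L[ℝ] E} (hw : w ∈ W) : U * w ∈ W := by
    induction hw using Submodule.span_induction with
    | mem w hw =>
      obtain ⟨i, rfl⟩ := hw
      simp only
      rw [← mul_assoc, ← pow_succ']
      exact hgen _
    | zero => simp
    | add v w _ _ hv hw => rw [mul_add]; exact W.add_mem hv hw
    | smul c w _ hw => rw [mul_smul_comm]; exact W.smul_mem c hw
  have hRW {w : E →L[ℝ] E} (hw : w ∈ W) : R * w ∈ W := by
    let L : W →ₗ[ℝ] W := (LinearMap.mulLeft ℝ U).restrict fun w hw => hUW hw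
    have hL (w : W) : (L w : E →L[ℝ] E) = U * w := rfl
    have hinj : Function.Injective L := fun v w hvw => by
      have := congrArg (fun z : W => R * (z : E →L[ℝ] E)) hvw
      simp only [hL, ← mul_assoc, hRU, hPW v.2, hPW w.2] at this
      exact Subtype.ext this
    obtain ⟨v, hv⟩ := LinearMap.injective_iff_surjective.mp hinj ⟨w, hw⟩
    have : w = U * v := congrArg Subtype.val hv.symm
    rw [this, ← mul_assoc, hRU, hPW v.2]
    exact v.2
  have hRnW (n : ℕ) : R ^ n * P ∈ W := by
    induction n with
    | zero => simpa using hgen 0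
    | succ n ih => rw [pow_succ', mul_assoc]; exact hRW ih
  obtain ⟨g, hg⟩ : ∃ g : ℕ → StrongDual ℝ (E →L[ℝ] E), ∀ n w,
      g n w = (t ^ n)⁻¹ * ∑ j, f j ((U ^ n) (w (y j))) :=
    ⟨fun n => (t ^ n)⁻¹ • ∑ j, (f j ∘L U ^ n) ∘L ContinuousLinearMap.apply ℝ E (y j),
      fun n w => by simp⟩
  have hbdd {w : E →L[ℝ] E} (hw : w ∈ W) :
      ∃ B, ∀ n, |g n w| ≤ B := by
    simp only [hg]
    induction hw using Submodule.span_induction with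
    | mem w hw =>
      obtain ⟨i, rfl⟩ := hw
      refine ⟨D * t ^ i, fun n => ?_⟩
      have h1 (j) : (U ^ n) ((U ^ i * P) (y j)) = (U ^ (n + i)) (y j) := by
        rw [mul_apply_eq_comp, hPy, pow_add, mul_apply_eq_comp]
      simp only [h1]
      rw [abs_mul, abs_of_pos (inv_pos.mpr (pow_pos ht n)), inv_mul_le_iff₀ (pow_pos ht n)]
      exact (hD _).trans_eq (by ring)
    | zero => exact ⟨0, by simp⟩
    | add v w _ _ hv hw =>
      obtain ⟨B, hB⟩ := hv
      obtain ⟨B', hB'⟩ := hw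
      refine ⟨B + B', fun n => ?_⟩
      simp only [add_apply, map_add, Finset.sum_add_distrib, mul_add]
      exact (abs_add_le _ _).trans (add_le_add (hB n) (hB' n))
    | smul c w _ hw =>
      obtain ⟨B, hB⟩ := hw
      refine ⟨|c| * B, fun n => ?_⟩
      simp only [smul_apply, map_smul, smul_eq_mul, ← Finset.mul_sum]
      rw [mul_left_comm, abs_mul]
      exact mul_le_mul_of_nonneg_left (hB n) (abs_nonneg c)
  obtain ⟨B, hB0, hB⟩ := exists_bound_on_finiteDimensional W g fun w hw => hbdd hw
  have hm (n : ℕ) : (m : ℝ) ≤ B * K * (t / s) ^ n := by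
    have h1 : U ^ n * (R ^ n * P) = P := by
      rw [← mul_assoc, ← hUR.mul_pow, ← hP_def, ← pow_succ]
      exact IsIdempotentElem.pow_succ_eq n hidem
    have h2 (j) : (U ^ n) ((R ^ n * P) (y j)) = y j := by
      rw [← mul_apply_eq_comp, h1, hPy]
    have h3 : g n (R ^ n * P) = (t ^ n)⁻¹ * m := by
      simp only [hg, h2, hfy]
      simp
    have h4 := (hB n _ (hRnW n)).trans (mul_le_mul_of_nonneg_left (hR n) hB0)
    rw [h3, abs_of_nonneg (by positivity), inv_mul_le_iff₀ (pow_pos ht n)] at h4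
    refine h4.trans_eq ?_
    rw [div_pow, inv_pow]
    ring
  have hlim : Tendsto (fun n : ℕ => B * K * (t / s) ^ n) atTop (𝓝 0) := by
    simpa using (tendsto_pow_atTop_nhds_zero_of_lt_one (by positivity)
      ((div_lt_one hs).mpr hts)).const_mul (B * K)
  have hm0 : m = 0 := by
    have : (m : ℝ) ≤ 0 := ge_of_tendsto' hlim hm
    exact_mod_cast this.antisymm m.cast_nonneg
  subst hm0
  ext x
  simp [hP]

/-- A compact operator together with a finite rank operator commuting with it, given in coordinates,
off which its powers decay at rate `t`. -/
structure SpectralData (E : Type*) [NormedAddCommGroup E] [NormedSpace ℝ E] (t : ℝ) where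
  V : E →L[ℝ] E
  isCompactOperator : IsCompactOperator V
  P : E →L[ℝ] E
  m : ℕ
  y : Fin m → E
  f : Fin m → StrongDual ℝ E
  P_apply : ∀ w, P w = ∑ j, f j w • y j
  commute : Commute V P
  C : ℝ
  norm_le : ∀ n : ℕ, ‖V ^ n * (1 - P)‖ ≤ C * t ^ n

/-- The trace of the `n`-th power on the finite rank part. -/
noncomputable def SpectralData.trace {E : Type*} [NormedAddCommGroup E] [NormedSpace ℝ E] {t : ℝ}
    (d : SpectralData E t) (n : ℕ) : ℝ := ∑ j, d.f j ((d.V ^ n) (d.y j))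

/-- Spectral data for `B * A` give spectral data for `A * B` with the same traces. -/
lemma SpectralData.exists_swap {E : Type*} [NormedAddCommGroup E] [NormedSpace ℝ E]
    [CompleteSpace E] {A B : E →L[ℝ] E} (hAB : IsCompactOperator (A * B))
    (hBA : IsCompactOperator (B * A)) {t : ℝ} (ht : 0 < t) :
    ∃ d d' : SpectralData E t, d.V = A * B ∧ d'.V = B * A ∧ ∀ n, d.trace n = d'.trace n := by
  obtain ⟨t', s, K, R, ht', hts, hst, hVR, hRVR, hK, -⟩ := exists_riesz_decomposition hBA ht
  set V := B * A with hV
  have hidem : IsIdempotentElem (V * R) := by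
    rw [IsIdempotentElem, mul_assoc, ← mul_assoc R, hRVR]
  obtain ⟨m, y, f, hP, hPy, -⟩ := exists_dual_basis_of_isIdempotentElem hidem (hBA.comp_clm R)
  have hK0 : 0 ≤ K := by simpa using (norm_nonneg _).trans (hK 0)
  have hKt (n : ℕ) : ‖V ^ n * (1 - V * R)‖ ≤ K * t ^ n :=
    (hK n).trans (by gcongr; linarith)
  have hpow (n : ℕ) : (A * B) ^ (n + 1) = A * V ^ n * B := by
    induction n with
    | zero => simp
    | succ n ih => rw [pow_succ', ih, pow_succ', hV]; noncomm_ring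
  have hpow' (n : ℕ) : B * (A * B) ^ n * A = V ^ (n + 1) := by
    induction n with
    | zero => simp [hV]
    | succ n ih => rw [pow_succ' V, ← ih, pow_succ', hV]; noncomm_ring
  have hRP : R * (V * R) = R := by rw [← mul_assoc, hRVR]
  refine ⟨{ V := A * B, isCompactOperator := hAB, P := A * R * B, m := m,
            y := fun j => A (R (y j)), f := fun j => f j ∘L B, P_apply := fun w => ?_,
            commute := ?_, C := ‖1 - A * R * B‖ + ‖A‖ * K * ‖B‖ / t, norm_le := fun n => ?_ },
    ⟨V, hBA, V * R, m, y, f, hP, (Commute.refl V).mul_right hVR, K, hKt⟩, rfl, rfl, fun n => ?_⟩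
  · have h1 : (A * R * B) w = A (R ((V * R) (B w))) := by
      rw [← mul_apply_eq_comp R, hRP]
      rfl
    rw [h1, hP]
    simp
  · have h1 : A * B * (A * R * B) = A * (V * R) * B := by rw [hV]; noncomm_ring
    have h2 : A * R * B * (A * B) = A * (R * V) * B := by rw [hV]; noncomm_ring
    rw [commute_iff_eq, h1, h2, hVR.eq]
  · cases n with
    | zero =>
      have : 0 ≤ ‖A‖ * K * ‖B‖ / t := by positivity
      simpa using this
    | succ n =>
      have h1 : (A * B) ^ (n + 1) * (1 - A * R * B) = A * (V ^ n * (1 - V * R)) * B := by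
        have : V ^ n * (1 - V * R) = V ^ n - V ^ n * B * A * R := by rw [hV]; noncomm_ring
        rw [hpow, this]
        noncomm_ring
      rw [h1]
      calc _ ≤ ‖A‖ * ‖V ^ n * (1 - V * R)‖ * ‖B‖ :=
            (norm_mul_le _ _).trans (by gcongr; exact norm_mul_le _ _)
        _ ≤ ‖A‖ * (K * t ^ n) * ‖B‖ := by gcongr; exact hKt n
        _ = (‖A‖ * K * ‖B‖ / t) * t ^ (n + 1) := by
          field_simp
          ring
        _ ≤ _ := by gcongr; exact le_add_of_nonneg_left (norm_nonneg _)
  · refine Finset.sum_congr rfl fun j _ => ?_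
    have h1 : (B * (A * B) ^ n * A) (R (y j)) = (V ^ n) ((V * R) (y j)) := by
      rw [hpow', pow_succ]
      rfl
    rw [hPy] at h1
    exact congrArg (f j) h1

section PositiveOperators

variable {E : Type*} [NormedAddCommGroup E] [Lattice E] [NormedSpace ℝ E]

/-- A bounded operator is positive if it maps positive elements to positive elements. -/
def IsPositiveOperator (T : E →L[ℝ] E) : Prop := ∀ x, 0 ≤ x → 0 ≤ T x

namespace IsPositiveOperator

variable {S T U V : E →L[ℝ] E}

lemma mul (hS : IsPositiveOperator S) (hT : IsPositiveOperator T) : IsPositiveOperator (S * T) :=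
  fun x hx => hS _ (hT x hx)

lemma pow (hS : IsPositiveOperator S) (n : ℕ) : IsPositiveOperator (S ^ n) := by
  induction n with
  | zero => exact fun x hx => hx
  | succ n ih => rw [pow_succ]; exact ih.mul hS

lemma sub_self (S : E →L[ℝ] E) : IsPositiveOperator (S - S) := by
  simp [IsPositiveOperator]

variable [IsOrderedAddMonoid E]

lemma add (hS : IsPositiveOperator S) (hT : IsPositiveOperator T) : IsPositiveOperator (S + T) :=
  fun x hx => add_nonneg (hS x hx) (hT x hx)

lemma of_sub (hS : IsPositiveOperator S) (h : IsPositiveOperator (T - S)) :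
    IsPositiveOperator T := by
  simpa using h.add hS

lemma mul_sub_mul (hS : IsPositiveOperator S) (hU : IsPositiveOperator U)
    (hST : IsPositiveOperator (T - S)) (hUV : IsPositiveOperator (V - U)) :
    IsPositiveOperator (T * V - S * U) := by
  have : T * V - S * U = (T - S) * V + S * (V - U) := by noncomm_ring
  rw [this]
  exact (hST.mul (hU.of_sub hUV)).add (hS.mul hUV)

lemma conj_sub_conj (hS : IsPositiveOperator S) (hST : IsPositiveOperator (T - S))
    (hU : IsPositiveOperator U) : IsPositiveOperator (T * U * T - S * U * S) := by
  have h : IsPositiveOperator (T * U - S * U) := hS.mul_sub_mul hU hST (sub_self U)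
  exact (hS.mul hU).mul_sub_mul hS h hST

lemma pow_sub_pow (hS : IsPositiveOperator S) (hST : IsPositiveOperator (T - S)) (n : ℕ) :
    IsPositiveOperator (T ^ n - S ^ n) := by
  induction n with
  | zero => intro x hx; simp
  | succ n ih => rw [pow_succ, pow_succ]; exact (hS.pow n).mul_sub_mul hS ih hST

lemma pow_sub_pow_sub_pow (hS : IsPositiveOperator S) (hU : IsPositiveOperator U)
    (h : IsPositiveOperator (T - S - U)) (n : ℕ) :
    IsPositiveOperator (T ^ (n + 1) - S ^ (n + 1) - U ^ (n + 1)) := by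
  have hTS : IsPositiveOperator (T - S) := hU.of_sub h
  have hTU : IsPositiveOperator (T - U) := hS.of_sub (by rwa [sub_right_comm])
  induction n with
  | zero => simpa using h
  | succ n ih =>
    have : T ^ (n + 1 + 1) - S ^ (n + 1 + 1) - U ^ (n + 1 + 1) =
        T * (T ^ (n + 1) - S ^ (n + 1) - U ^ (n + 1)) + (T - S) * S ^ (n + 1) +
          (T - U) * U ^ (n + 1) := by
      rw [pow_succ' T (n + 1), pow_succ' S (n + 1), pow_succ' U (n + 1)]
      noncomm_ring
    rw [this]
    exact (((hS.of_sub hTS).mul ih).add (hTS.mul (hS.pow _))).add (hTU.mul (hU.pow _))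

lemma norm_le_norm [HasSolidNorm E] (hS : IsPositiveOperator S)
    (hST : IsPositiveOperator (T - S)) :
    ‖S‖ ≤ ‖T‖ := by
  refine S.opNorm_le_bound (norm_nonneg _) fun x => ?_
  have h1 : |S x| ≤ S |x| := by
    have h2 := hS _ (sub_nonneg.mpr (le_abs_self x))
    have h3 := hS _ (sub_nonneg.mpr (neg_le_abs x))
    rw [map_sub, sub_nonneg] at h2 h3
    rw [map_neg] at h3
    exact abs_le'.mpr ⟨h2, h3⟩
  have h4 : S |x| ≤ T |x| := sub_nonneg.mp (hST _ (abs_nonneg x))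
  rw [← norm_abs_eq_norm (S x), ← norm_abs_eq_norm x]
  exact (norm_le_norm_of_nonneg_of_le (abs_nonneg _) (h1.trans h4)).trans (T.le_opNorm _)

end IsPositiveOperator

/-- If `A * B ≥ B * A + U` with `B * A` and `U` positive, all three operators being compact, then
`U` is quasi-nilpotent. -/
lemma exists_norm_pow_le_of_isPositiveOperator [IsOrderedAddMonoid E] [HasSolidNorm E]
    [CompleteSpace E] {A B U : E →L[ℝ] E}
    (hAB : IsCompactOperator (A * B)) (hBA : IsCompactOperator (B * A)) (hU : IsCompactOperator U)
    (hBA0 : IsPositiveOperator (B * A)) (hU0 : IsPositiveOperator U)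
    (hle : IsPositiveOperator (A * B - B * A - U)) {δ : ℝ} (hδ : 0 < δ) :
    ∃ K, ∀ n : ℕ, ‖U ^ n‖ ≤ K * δ ^ n := by
  obtain ⟨t, s, K, R, ht, hts, hsδ, hUR, hRUR, hK, hKR⟩ := exists_riesz_decomposition hU hδ
  have hK0 : 0 ≤ K := by simpa using (norm_nonneg _).trans (hK 0)
  have hidem : IsIdempotentElem (U * R) := by
    rw [IsIdempotentElem, mul_assoc, ← mul_assoc R, hRUR]
  obtain ⟨m, y, f, hP, hPy, hfy⟩ := exists_dual_basis_of_isIdempotentElem hidem (hU.comp_clm R)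
  obtain ⟨dT, dS, hdT, hdS, htrace⟩ := SpectralData.exists_swap hAB hBA ht
  let dU : SpectralData E t :=
    ⟨U, hU, U * R, m, y, f, hP, (Commute.refl U).mul_right hUR, K, hK⟩
  let d : Fin 3 → SpectralData E t := ![dT, dS, dU]
  obtain ⟨D, hD⟩ := exists_positive_approximate_trace (fun i => (d i).isCompactOperator)
    (fun i => (d i).P_apply) (fun i => (d i).commute) ht (fun i => (d i).norm_le)
  have hD0 : 0 ≤ D := by
    obtain ⟨α, _, x, φ, hx, hφ, h⟩ := hD 0
    simpa using (abs_nonneg _).trans (h 0)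
  have hbound (n : ℕ) : |dU.trace n| ≤ (3 * D + |dU.trace 0|) * t ^ n := by
    cases n with
    | zero => simpa using hD0
    | succ n =>
      obtain ⟨α, _, x, φ, hx, hφ, h⟩ := hD (n + 1)
      have h0 : |∑ a, φ a ((dT.V ^ (n + 1)) (x a)) - dT.trace (n + 1)| ≤ D * t ^ (n + 1) := h 0
      have h1 : |∑ a, φ a ((dS.V ^ (n + 1)) (x a)) - dS.trace (n + 1)| ≤ D * t ^ (n + 1) := h 1
      have h2 : |∑ a, φ a ((U ^ (n + 1)) (x a)) - dU.trace (n + 1)| ≤ D * t ^ (n + 1) := h 2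
      rw [hdT, htrace] at h0
      rw [hdS] at h1
      have h3 : 0 ≤ ∑ a, φ a ((U ^ (n + 1)) (x a)) :=
        Finset.sum_nonneg fun a _ => hφ a _ (hU0.pow _ _ (hx a))
      have h4 : 0 ≤ ∑ a, φ a (((A * B) ^ (n + 1) - (B * A) ^ (n + 1) - U ^ (n + 1)) (x a)) :=
        Finset.sum_nonneg fun a _ => hφ a _ (hBA0.pow_sub_pow_sub_pow hU0 hle n _ (hx a))
      simp only [sub_apply, map_sub, Finset.sum_sub_distrib] at h4
      rw [abs_le] at h0 h1 h2
      have h5 : 0 ≤ |dU.trace 0| * t ^ (n + 1) := by positivity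
      rw [abs_le]
      constructor <;> nlinarith
  have hzero := mul_eq_zero_of_abs_trace_pow_le hUR hRUR hP hPy hfy ht hts hKR hbound
  refine ⟨K, fun n => ?_⟩
  have := hK n
  rw [hzero, sub_zero, mul_one] at this
  refine this.trans ?_
  gcongr
  linarith

/-- The powers of the commutator of `A` and `B` decay superexponentially along a progression. -/
lemma exists_norm_commutator_pow_le [IsOrderedAddMonoid E] [HasSolidNorm E] [CompleteSpace E]
    {A B X Y C : E →L[ℝ] E} (hX : A * B = X) (hY : B * A = Y) (hXYC : X - Y = C)
    (hY0 : IsPositiveOperator Y) (hC0 : IsPositiveOperator C) {N : ℕ}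
    (hN : IsCompactOperator (X ^ N)) {δ : ℝ} (hδ : 0 < δ) :
    ∃ K, ∀ n : ℕ, ‖C ^ ((2 * N + 1) * n)‖ ≤ K * δ ^ n := by
  have hXY : IsPositiveOperator (X - Y) := hXYC ▸ hC0
  have hXC : IsPositiveOperator (X - C) := by rwa [← hXYC, sub_sub_cancel]
  have hX0 : IsPositiveOperator X := hY0.of_sub hXY
  have hpow (Z : E →L[ℝ] E) : Z ^ (2 * N + 1) = Z ^ N * Z * Z ^ N := by
    rw [← pow_succ, ← pow_add]
    congr 1
    lia
  have hAB : A * (B * X ^ (2 * N)) = X ^ N * X * X ^ N := by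
    rw [← mul_assoc, hX, ← pow_succ', hpow]
  have hswap (k : ℕ) : B * X ^ k * A = Y ^ (k + 1) := by
    induction k with
    | zero => simp [hY]
    | succ k ih =>
      rw [pow_succ' Y, ← ih, pow_succ', ← hX, ← hY]
      simp only [mul_assoc]
  have hBA : B * X ^ (2 * N) * A = Y ^ N * Y * Y ^ N := by rw [hswap, hpow]
  have hBA_compact : IsCompactOperator (B * X ^ (2 * N) * A) := by
    rw [two_mul, pow_add, ← mul_assoc]
    exact (hN.comp_clm A).clm_comp (B * X ^ N)
  have hAB_compact : IsCompactOperator (A * (B * X ^ (2 * N))) := by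
    rw [hAB]
    exact hN.clm_comp (X ^ N * X)
  have hU_compact : IsCompactOperator (X ^ N * C * X ^ N) := hN.clm_comp (X ^ N * C)
  have hle : IsPositiveOperator
      (A * (B * X ^ (2 * N)) - B * X ^ (2 * N) * A - X ^ N * C * X ^ N) := by
    have h : A * (B * X ^ (2 * N)) - B * X ^ (2 * N) * A - X ^ N * C * X ^ N =
        X ^ N * Y * X ^ N - Y ^ N * Y * Y ^ N := by
      rw [hAB, hBA, ← hXYC, mul_sub, sub_mul]
      abel
    rw [h]
    exact (hY0.pow N).conj_sub_conj (hY0.pow_sub_pow hXY N) hY0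
  have hCU : IsPositiveOperator (X ^ N * C * X ^ N - C ^ (2 * N + 1)) := by
    rw [hpow]
    exact (hC0.pow N).conj_sub_conj (hC0.pow_sub_pow hXC N) hC0
  obtain ⟨K, hK⟩ := exists_norm_pow_le_of_isPositiveOperator hAB_compact hBA_compact
    hU_compact (hBA ▸ ((hY0.pow N).mul hY0).mul (hY0.pow N))
    (((hX0.pow N).mul hC0).mul (hX0.pow N)) hle hδ
  refine ⟨K, fun n => ?_⟩
  rw [pow_mul]
  exact (((hC0.pow _).pow n).norm_le_norm ((hC0.pow _).pow_sub_pow hCU n)).trans (hK n)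

end PositiveOperators

lemma tendsto_norm_pow_rpow_zero {R : Type*} [SeminormedRing R] {c : R} {M : ℕ} (hM : 0 < M)
    (h : ∀ δ : ℝ, 0 < δ → ∃ K, ∀ n : ℕ, ‖c ^ (M * n)‖ ≤ K * δ ^ n) :
    Tendsto (fun n : ℕ => ‖c ^ n‖ ^ (1 / (n : ℝ))) atTop (𝓝 0) := by
  have hbound (ε : ℝ) (hε : 0 < ε) : ∃ K, 0 < K ∧ ∀ n : ℕ, ‖c ^ n‖ ≤ K * ε ^ n := by
    obtain ⟨K, hK⟩ := h (ε ^ M) (pow_pos hε M)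
    have hK0 : 0 ≤ K := by simpa using (norm_nonneg _).trans (hK 0)
    refine ⟨K * ∑ r ∈ Finset.range M, ‖c ^ r‖ * (ε ^ r)⁻¹ + 1, by positivity, fun n => ?_⟩
    have h1 : ‖c ^ (n % M)‖ * (ε ^ (n % M))⁻¹ ≤
        ∑ r ∈ Finset.range M, ‖c ^ r‖ * (ε ^ r)⁻¹ :=
      Finset.single_le_sum (f := fun r => ‖c ^ r‖ * (ε ^ r)⁻¹) (fun r _ => by positivity)
        (Finset.mem_range.mpr (n.mod_lt hM))
    calc ‖c ^ n‖ = ‖c ^ (M * (n / M)) * c ^ (n % M)‖ := by rw [← pow_add, Nat.div_add_mod]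
      _ ≤ (K * (ε ^ M) ^ (n / M)) * ‖c ^ (n % M)‖ :=
        (norm_mul_le _ _).trans (by gcongr; exact hK _)
      _ = K * (‖c ^ (n % M)‖ * (ε ^ (n % M))⁻¹) * ε ^ n := by
        conv_rhs => rw [← Nat.div_add_mod n M, Nat.mul_add_mod, Nat.mod_mod, pow_add, pow_mul]
        field_simp
      _ ≤ (K * ∑ r ∈ Finset.range M, ‖c ^ r‖ * (ε ^ r)⁻¹) * ε ^ n := by gcongr
      _ ≤ _ := by gcongr; linarith
  refine tendsto_order.mpr ⟨fun a ha => Eventually.of_forall fun n => ha.trans_le (by positivity),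
    fun a ha => ?_⟩
  obtain ⟨K, hK0, hK⟩ := hbound (a / 2) (half_pos ha)
  have hlim : Tendsto (fun n : ℕ => K ^ (1 / (n : ℝ)) * (a / 2)) atTop (𝓝 (a / 2)) := by
    have := ((Real.continuousAt_const_rpow (b := 0) hK0.ne').tendsto.comp
      tendsto_one_div_atTop_nhds_zero_nat).mul_const (a / 2)
    simpa using this
  filter_upwards [hlim.eventually_lt_const (half_lt_self ha), eventually_ge_atTop 1] with n hn hn1
  refine lt_of_le_of_lt ?_ hn
  have hn0 : (n : ℝ) ≠ 0 := by positivity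
  calc ‖c ^ n‖ ^ (1 / (n : ℝ)) ≤ (K * (a / 2) ^ n) ^ (1 / (n : ℝ)) :=
        Real.rpow_le_rpow (norm_nonneg _) (hK n) (by positivity)
    _ = K ^ (1 / (n : ℝ)) * (a / 2) := by
        rw [Real.mul_rpow hK0.le (by positivity), one_div,
          Real.pow_rpow_inv_natCast (by positivity) (by lia)]

/-- If `A B ≥ B A ≥ 0` on a Banach lattice `E` and `A B` is power-compact,
then the commutator `C = A B - B A` is quasi-nilpotent. -/
theorem stmt0 {E : Type*} [NormedAddCommGroup E] [Lattice E] [HasSolidNorm E] [IsOrderedAddMonoid E] [NormedSpace ℝ E] [CompleteSpace E]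
    (A B : E →L[ℝ] E)
    (hBA : ∀ x : E, 0 ≤ x → 0 ≤ (B * A) x)
    (hC : ∀ x : E, 0 ≤ x → 0 ≤ (A * B - B * A) x)
    (hAB : ∃ n : ℕ, 1 ≤ n ∧ IsCompactOperator ⇑((A * B) ^ n)) :
    Tendsto (fun n : ℕ => ‖(A * B - B * A) ^ n‖ ^ (1 / (n : ℝ))) atTop (𝓝 0) := by
  obtain ⟨N, -, hN⟩ := hAB
  exact tendsto_norm_pow_rpow_zero (2 * N).succ_pos fun δ hδ =>
    exists_norm_commutator_pow_le rfl rfl rfl hBA hC hN hδ
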